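/- Let n be a positive integer and let ε, δ be real numbers with 0 ≤ ε < 1/12 and 0 ≤ δ < (1 − 12ε)²/10409. Then every ε-dense partial latin square of order n having at most δ·n² filled cells has a completion to a latin square of order n. -/

import Mathlib

/-- A partial latin square of order `n`: each symbol occurs at most once in
each row and at most once in each column. -/
def IsPartialLatinSquare {n : ℕ} (P : Fin n → Fin n → Option (Fin n)) : Prop :=
  (∀ i j j' s, P i j = some s → P i j' = some s → j = j') ∧
  (∀ i i' j s, P i j = some s → P i' j = some s → i = i')

/-- `P` is `ε`-dense: every row, column, and symbol of `P` has at most `ε * n`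
filled cells. -/
def IsEpsDense {n : ℕ} (ε : ℝ) (P : Fin n → Fin n → Option (Fin n)) : Prop :=
  (∀ i, ((Finset.univ.filter fun j => (P i j).isSome).card : ℝ) ≤ ε * n) ∧
  (∀ j, ((Finset.univ.filter fun i => (P i j).isSome).card : ℝ) ≤ ε * n) ∧
  (∀ s, ((Finset.univ.filter fun p : Fin n × Fin n => P p.1 p.2 = some s).card : ℝ) ≤ ε * n)

/-- A latin square of order `n`: every row and every column contains each
symbol exactly once. -/
def IsLatinSquare {n : ℕ} (L : Fin n → Fin n → Fin n) : Prop :=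
  (∀ i, Function.Bijective (L i)) ∧ (∀ j, Function.Bijective fun i => L i j)

/-- `L` completes `P`. -/
def Completes {n : ℕ} (L : Fin n → Fin n → Fin n)
    (P : Fin n → Fin n → Option (Fin n)) : Prop :=
  ∀ i j s, P i j = some s → L i j = s

/-- The number of filled cells of a partial latin square. -/
def filledCells {n : ℕ} (P : Fin n → Fin n → Option (Fin n)) : ℕ :=
  (Finset.univ.filter fun p : Fin n × Fin n => P p.1 p.2 ≠ none).card

namespace LSQ
open scoped Classical

structure Lat {α : Type} (T : α → α → α → Prop) : Prop where
  e1 : ∀ y z, ∃ x, T x y z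
  e2 : ∀ x z, ∃ y, T x y z
  e3 : ∀ x y, ∃ z, T x y z
  u1 : ∀ {x x' y z}, T x y z → T x' y z → x = x'
  u2 : ∀ {x y y' z}, T x y z → T x y' z → y = y'
  u3 : ∀ {x y z z'}, T x y z → T x y z' → z = z'

/-- cyclic conjugate -/
def cyc {α : Type} (T : α → α → α → Prop) : α → α → α → Prop := fun a b c => T b c a
/-- swap of the first two coordinates -/
def s12 {α : Type} (T : α → α → α → Prop) : α → α → α → Prop := fun a b c => T b a c
/-- swap of the last two coordinates -/
def s23 {α : Type} (T : α → α → α → Prop) : α → α → α → Prop := fun a b c => T a c b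

theorem Lat.cyc {α : Type} {T : α → α → α → Prop} (h : Lat T) : Lat (cyc T) :=
  ⟨fun y z => h.e3 y z, fun x z => h.e1 z x, fun x y => h.e2 y x,
   fun a b => h.u3 a b, fun a b => h.u1 a b, fun a b => h.u2 a b⟩
theorem Lat.s12 {α : Type} {T : α → α → α → Prop} (h : Lat T) : Lat (s12 T) :=
  ⟨fun y z => h.e2 y z, fun x z => h.e1 x z, fun x y => h.e3 y x,
   fun a b => h.u2 a b, fun a b => h.u1 a b, fun a b => h.u3 a b⟩
theorem Lat.s23 {α : Type} {T : α → α → α → Prop} (h : Lat T) : Lat (s23 T) :=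
  ⟨fun y z => h.e1 z y, fun x z => h.e3 x z, fun x y => h.e2 x y,
   fun a b => h.u1 a b, fun a b => h.u3 a b, fun a b => h.u2 a b⟩

def tr {α : Type} (T : α → α → α → Prop) (R A : List (α × α × α)) : α → α → α → Prop :=
  fun x y z => (T x y z ∧ (x, y, z) ∉ R) ∨ (x, y, z) ∈ A

def p12 {α : Type} : α × α × α → α × α := fun p => (p.1, p.2.1)
def p13 {α : Type} : α × α × α → α × α := fun p => (p.1, p.2.2)
def p23 {α : Type} : α × α × α → α × α := fun p => (p.2.1, p.2.2)

theorem trade_aux {β γ : Type} (f : β → γ) (T : β → Prop) (hs : ∀ c, ∃ b, T b ∧ f b = c)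
    (hi : ∀ b b', T b → T b' → f b = f b' → b = b') (R A : List β) (hn : R.Nodup)
    (hR : ∀ b ∈ R, T b) (hp : (R.map f).Perm (A.map f)) :
    (∀ c, ∃ b, ((T b ∧ b ∉ R) ∨ b ∈ A) ∧ f b = c) ∧
    (∀ b b', ((T b ∧ b ∉ R) ∨ b ∈ A) → ((T b' ∧ b' ∉ R) ∨ b' ∈ A) → f b = f b' → b = b') := by
  have hnA : (A.map f).Nodup := by
    rw [← hp.nodup_iff]
    exact List.Nodup.map_on (fun x hx y hy h => hi x y (hR x hx) (hR y hy) h) hn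
  have key : ∀ b b', T b → b ∉ R → b' ∈ A → f b = f b' → False := by
    intro b b' h1 h2 h3 h4
    have : f b' ∈ R.map f := hp.mem_iff.mpr (List.mem_map_of_mem h3)
    obtain ⟨b2, hb2, he⟩ := List.mem_map.mp this
    have := hi b b2 h1 (hR _ hb2) (h4.trans he.symm)
    exact h2 (this ▸ hb2)
  constructor
  · intro c
    obtain ⟨b, hb, hc⟩ := hs c
    by_cases h : b ∈ R
    · have : f b ∈ A.map f := hp.mem_iff.mp (List.mem_map_of_mem h)
      obtain ⟨b2, hb2, he⟩ := List.mem_map.mp this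
      exact ⟨b2, Or.inr hb2, he.trans hc⟩
    · exact ⟨b, Or.inl ⟨hb, h⟩, hc⟩
  · rintro b b' (⟨h1, h2⟩ | h1) (⟨h3, h4⟩ | h3) h
    · exact hi _ _ h1 h3 h
    · exact (key b b' h1 h2 h3 h).elim
    · exact (key b' b h3 h4 h1 h.symm).elim
    · exact List.inj_on_of_nodup_map hnA h1 h3 h

theorem trade {α : Type} {T : α → α → α → Prop} (hT : Lat T) (R A : List (α × α × α))
    (hn : R.Nodup) (hR : ∀ b ∈ R, T b.1 b.2.1 b.2.2) (h12 : (R.map p12).Perm (A.map p12))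
    (h13 : (R.map p13).Perm (A.map p13)) (h23 : (R.map p23).Perm (A.map p23)) :
    Lat (tr T R A) := by
  have t12 := trade_aux p12 (fun b : α × α × α => T b.1 b.2.1 b.2.2)
    (fun c => by obtain ⟨z, hz⟩ := hT.e3 c.1 c.2; exact ⟨(c.1, c.2, z), hz, rfl⟩)
    (by
      rintro ⟨x, y, z⟩ ⟨x', y', z'⟩ h h' he
      simp only [p12, Prod.mk.injEq] at he
      obtain ⟨rfl, rfl⟩ := he
      dsimp only at h h'
      rw [hT.u3 h h']) R A hn hR h12
  have t13 := trade_aux p13 (fun b : α × α × α => T b.1 b.2.1 b.2.2)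
    (fun c => by obtain ⟨z, hz⟩ := hT.e2 c.1 c.2; exact ⟨(c.1, z, c.2), hz, rfl⟩)
    (by
      rintro ⟨x, y, z⟩ ⟨x', y', z'⟩ h h' he
      simp only [p13, Prod.mk.injEq] at he
      obtain ⟨rfl, rfl⟩ := he
      dsimp only at h h'
      rw [hT.u2 h h']) R A hn hR h13
  have t23 := trade_aux p23 (fun b : α × α × α => T b.1 b.2.1 b.2.2)
    (fun c => by obtain ⟨z, hz⟩ := hT.e1 c.1 c.2; exact ⟨(z, c.1, c.2), hz, rfl⟩)
    (by
      rintro ⟨x, y, z⟩ ⟨x', y', z'⟩ h h' he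
      simp only [p23, Prod.mk.injEq] at he
      obtain ⟨rfl, rfl⟩ := he
      dsimp only at h h'
      rw [hT.u1 h h']) R A hn hR h23
  refine ⟨?_, ?_, ?_, ?_, ?_, ?_⟩
  · intro y z
    obtain ⟨⟨a, b, c⟩, h, he⟩ := t23.1 (y, z)
    simp only [p23, Prod.mk.injEq] at he
    obtain ⟨rfl, rfl⟩ := he
    exact ⟨a, h⟩
  · intro y z
    obtain ⟨⟨a, b, c⟩, h, he⟩ := t13.1 (y, z)
    simp only [p13, Prod.mk.injEq] at he
    obtain ⟨rfl, rfl⟩ := he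
    exact ⟨b, h⟩
  · intro y z
    obtain ⟨⟨a, b, c⟩, h, he⟩ := t12.1 (y, z)
    simp only [p12, Prod.mk.injEq] at he
    obtain ⟨rfl, rfl⟩ := he
    exact ⟨c, h⟩
  · intro x x' y z h h'
    have := t23.2 (x, y, z) (x', y, z) h h' rfl
    simpa using this
  · intro x y y' z h h'
    have := t13.2 (x, y, z) (x, y', z) h h' rfl
    simpa using this
  · intro x y z z' h h'
    have := t12.2 (x, y, z) (x, y, z') h h' rfl
    simpa using this

variable {α : Type} [Fintype α]

noncomputable def RL (B : α → α → α → Prop) (x : α) : ℕ :=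
  (Finset.univ.filter fun p : α × α => B x p.1 p.2).card
noncomputable def CL (B : α → α → α → Prop) (y : α) : ℕ :=
  (Finset.univ.filter fun p : α × α => B p.1 y p.2).card
noncomputable def SL (B : α → α → α → Prop) (z : α) : ℕ :=
  (Finset.univ.filter fun p : α × α => B p.1 p.2 z).card

theorem card_swap (Q : α → α → Prop) :
    (Finset.univ.filter fun p : α × α => Q p.2 p.1).card =
    (Finset.univ.filter fun p : α × α => Q p.1 p.2).card := by
  refine Finset.card_bij (fun p _ => (p.2, p.1)) ?_ ?_ ?_
  · simp
  · rintro ⟨a, b⟩ _ ⟨c, d⟩ _ h; simp_all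
  · rintro ⟨a, b⟩ h; exact ⟨(b, a), by simpa using h, rfl⟩

theorem RL_cyc (B : α → α → α → Prop) (x : α) : RL (cyc B) x = SL B x := rfl
theorem CL_cyc (B : α → α → α → Prop) (x : α) : CL (cyc B) x = RL B x :=
  card_swap (fun a b => B x a b)
theorem SL_cyc (B : α → α → α → Prop) (x : α) : SL (cyc B) x = CL B x :=
  card_swap (fun a b => B a x b)
theorem RL_s12 (B : α → α → α → Prop) (x : α) : RL (s12 B) x = CL B x := rfl
theorem CL_s12 (B : α → α → α → Prop) (x : α) : CL (s12 B) x = RL B x := rfl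
theorem SL_s12 (B : α → α → α → Prop) (x : α) : SL (s12 B) x = SL B x :=
  card_swap (fun a b => B a b x)
theorem RL_s23 (B : α → α → α → Prop) (x : α) : RL (s23 B) x = RL B x :=
  card_swap (fun a b => B x a b)
theorem CL_s23 (B : α → α → α → Prop) (x : α) : CL (s23 B) x = SL B x := rfl
theorem SL_s23 (B : α → α → α → Prop) (x : α) : SL (s23 B) x = CL B x := rfl

noncomputable def cnt (X : α → Prop) : ℕ := (Finset.univ.filter X).card

structure Frame (M D : α → α → α → Prop) (τ : α → Bool) (k : ℕ) : Prop where
  lat : Lat M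
  par : ∀ x y z, M x y z → ¬ D x y z → xor (τ x) (xor (τ y) (τ z)) = false
  flip : ∀ x1 x2 y1 y2 z1 z2, M x2 y1 z1 → M x1 y2 z1 → M x1 y1 z2 →
    ¬ D x2 y1 z1 → ¬ D x1 y2 z1 → ¬ D x1 y1 z2 → τ x1 ≠ τ x2 →
    ((∀ v, ¬ D x2 y2 v) ∨ (∀ v, ¬ D x2 v z2) ∨ (∀ v, ¬ D v y2 z2)) → M x2 y2 z2
  big : ∀ b, k ≤ cnt (fun x => τ x = b)
  ld : ∀ x y z, M x y z → ¬ D x y z → RL D x ≤ 2 ∧ CL D y ≤ 2 ∧ SL D z ≤ 2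

theorem Frame.cyc {M D : α → α → α → Prop} {τ : α → Bool} {k : ℕ} (h : Frame M D τ k) :
    Frame (cyc M) (cyc D) τ k := by
  refine ⟨h.lat.cyc, ?_, ?_, h.big, ?_⟩
  · intro x y z h1 h2
    have := h.par _ _ _ h1 h2
    revert this; cases τ x <;> cases τ y <;> cases τ z <;> simp
  · intro x1 x2 y1 y2 z1 z2 h1 h2 h3 d1 d2 d3 ht hv
    refine h.flip y1 y2 z1 z2 x1 x2 h2 h3 h1 d2 d3 d1 ?_ (by unfold LSQ.cyc at hv; tauto)
    have p1 := h.par _ _ _ h1 d1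
    have p2 := h.par _ _ _ h2 d2
    have p3 := h.par _ _ _ h3 d3
    revert p1 p2 p3 ht
    cases τ x1 <;> cases τ x2 <;> cases τ y1 <;> cases τ y2 <;> cases τ z1 <;> simp
  · intro x y z h1 h2
    rw [RL_cyc, CL_cyc, SL_cyc]
    have := h.ld _ _ _ h1 h2
    tauto

theorem Frame.s12 {M D : α → α → α → Prop} {τ : α → Bool} {k : ℕ} (h : Frame M D τ k) :
    Frame (s12 M) (s12 D) τ k := by
  refine ⟨h.lat.s12, ?_, ?_, h.big, ?_⟩
  · intro x y z h1 h2
    have := h.par _ _ _ h1 h2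
    revert this; cases τ x <;> cases τ y <;> cases τ z <;> simp
  · intro x1 x2 y1 y2 z1 z2 h1 h2 h3 d1 d2 d3 ht hv
    refine h.flip y1 y2 x1 x2 z1 z2 h2 h1 h3 d2 d1 d3 ?_ (by unfold LSQ.s12 at hv; tauto)
    have p1 := h.par _ _ _ h1 d1
    have p2 := h.par _ _ _ h2 d2
    have p3 := h.par _ _ _ h3 d3
    revert p1 p2 p3 ht
    cases τ x1 <;> cases τ x2 <;> cases τ y1 <;> cases τ y2 <;> cases τ z1 <;> simp
  · intro x y z h1 h2
    rw [RL_s12, CL_s12, SL_s12]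
    have := h.ld _ _ _ h1 h2
    tauto

theorem Frame.s23 {M D : α → α → α → Prop} {τ : α → Bool} {k : ℕ} (h : Frame M D τ k) :
    Frame (s23 M) (s23 D) τ k := by
  refine ⟨h.lat.s23, ?_, ?_, h.big, ?_⟩
  · intro x y z h1 h2
    have := h.par _ _ _ h1 h2
    revert this; cases τ x <;> cases τ y <;> cases τ z <;> simp
  · intro x1 x2 y1 y2 z1 z2 h1 h2 h3 d1 d2 d3 ht hv
    exact h.flip x1 x2 z1 z2 y1 y2 h1 h3 h2 d1 d3 d2 ht (by unfold LSQ.s23 at hv; tauto)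
  · intro x y z h1 h2
    rw [RL_s23, CL_s23, SL_s23]
    have := h.ld _ _ _ h1 h2
    tauto

end LSQ

namespace LSQ
open scoped Classical

theorem perm_of {γ : Type} (l l' : List γ) (d : γ) (π : List ℕ) (n : ℕ)
    (hn : l.length = n) (hπ : (List.range n).Perm π) (h : l' = π.map (fun i => l.getD i d)) : l.Perm l' := by
  subst hn
  have : l = (List.range l.length).map (fun i => l.getD i d) := by
    apply List.ext_getElem
    · simp
    · intro i h1 h2
      simp [List.getElem?_eq_getElem h1]
  rw [h]
  conv_lhs => rw [this]
  exact hπ.map _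

structure SwapOut {α : Type} (T T' P : α → α → α → Prop) (FR FC FS : Finset α)
    (r y1 y2 a b : α) (R : List (α × α × α)) (QR QC QS : Finset α) : Prop where
  lat : Lat T'
  n1 : T' r y1 b
  n2 : T' r y2 a
  len : R.length ≤ 12
  rem : ∀ x y z, T x y z → ¬ T' x y z → (x, y, z) ∈ R ∧ ¬ P x y z
  cR : QR.card ≤ 5
  cC : QC.card ≤ 5
  cS : QS.card ≤ 5
  offR : ∀ x y z, x ∉ QR → (T' x y z ↔ T x y z)
  offC : ∀ x y z, y ∉ QC → (T' x y z ↔ T x y z)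
  offS : ∀ x y z, z ∉ QS → (T' x y z ↔ T x y z)
  avR : ∀ x ∈ FR, x ≠ r → x ∉ QR
  avC : ∀ y ∈ FC, y ≠ y1 → y ≠ y2 → y ∉ QC
  avS : ∀ z ∈ FS, z ≠ a → z ≠ b → z ∉ QS
  stay : ∀ y z, T r y z → y ≠ y1 → y ≠ y2 → T' r y z

theorem swapOut_mk {α : Type} {T P : α → α → α → Prop} (hT : Lat T) {FR FC FS : Finset α}
    {r y1 y2 a b : α} (R A : List (α × α × α)) (QR QC QS : Finset α)
    (hn : R.Nodup) (hR : ∀ p ∈ R, T p.1 p.2.1 p.2.2 ∧ ¬ P p.1 p.2.1 p.2.2)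
    (h12 : (R.map p12).Perm (A.map p12))
    (h13 : (R.map p13).Perm (A.map p13)) (h23 : (R.map p23).Perm (A.map p23))
    (len : R.length ≤ 12) (n1 : (r, y1, b) ∈ A) (n2 : (r, y2, a) ∈ A)
    (cR : QR.card ≤ 5) (cC : QC.card ≤ 5) (cS : QS.card ≤ 5)
    (hQR : ∀ p ∈ R, p.1 ∈ QR) (hQC : ∀ p ∈ R, p.2.1 ∈ QC) (hQS : ∀ p ∈ R, p.2.2 ∈ QS)
    (avR : ∀ x ∈ FR, x ≠ r → x ∉ QR)
    (avC : ∀ y ∈ FC, y ≠ y1 → y ≠ y2 → y ∉ QC)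
    (avS : ∀ z ∈ FS, z ≠ a → z ≠ b → z ∉ QS)
    (hst : ∀ p ∈ R, p.1 = r → p.2.1 = y1 ∨ p.2.1 = y2) :
    SwapOut T (tr T R A) P FR FC FS r y1 y2 a b R QR QC QS := by
  have key : ∀ p ∈ A, p.1 ∈ QR ∧ p.2.1 ∈ QC ∧ p.2.2 ∈ QS := by
    intro p hp
    have h1 : p12 p ∈ R.map p12 := h12.mem_iff.mpr (List.mem_map_of_mem hp)
    have h2 : p23 p ∈ R.map p23 := h23.mem_iff.mpr (List.mem_map_of_mem hp)
    obtain ⟨p1, m1, e1⟩ := List.mem_map.mp h1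
    obtain ⟨p2, m2, e2⟩ := List.mem_map.mp h2
    simp only [p12, p23, Prod.mk.injEq] at e1 e2
    exact ⟨e1.1 ▸ hQR _ m1, e1.2 ▸ hQC _ m1, e2.2 ▸ hQS _ m2⟩
  refine ⟨trade hT R A hn (fun p hp => (hR p hp).1) h12 h13 h23, Or.inr n1, Or.inr n2, len, ?_,
    cR, cC, cS, ?_, ?_, ?_, avR, avC, avS, ?_⟩
  · intro x y z h h'
    have : (x, y, z) ∈ R := by
      by_contra hc
      exact h' (Or.inl ⟨h, hc⟩)
    exact ⟨this, (hR _ this).2⟩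
  · intro x y z hx
    have h1 : (x, y, z) ∉ R := fun h => hx (hQR _ h)
    have h2 : (x, y, z) ∉ A := fun h => hx (key _ h).1
    simp [tr, h1, h2]
  · intro x y z hx
    have h1 : (x, y, z) ∉ R := fun h => hx (hQC _ h)
    have h2 : (x, y, z) ∉ A := fun h => hx (key _ h).2.1
    simp [tr, h1, h2]
  · intro x y z hx
    have h1 : (x, y, z) ∉ R := fun h => hx (hQS _ h)
    have h2 : (x, y, z) ∉ A := fun h => hx (key _ h).2.2
    simp [tr, h1, h2]
  · intro y z h h1 h2
    refine Or.inl ⟨h, fun hm => ?_⟩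
    rcases hst _ hm rfl with h | h
    · exact h1 h
    · exact h2 h

theorem card5 {α : Type} (a b c d e : α) : ({a, b, c, d, e} : Finset α).card ≤ 5 :=
  Finset.card_le_five

theorem match_core {α : Type} {T P : α → α → α → Prop} (hT : Lat T) {FR FC FS : Finset α}
    {r y1 y2 a b q q2 q2' d1 d2 v1 v2 : α} (hr : r ∈ FR)
    (hy : y1 ≠ y2) (hab : a ≠ b) (hq : q ∉ FR) (hq2 : q2 ∉ FR) (hq2' : q2' ∉ FR)
    (hqq2 : q ≠ q2) (hqq2' : q ≠ q2') (hd1 : d1 ∉ FC) (hd2 : d2 ∉ FC) (hv1 : v1 ∉ FS)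
    (hv2 : v2 ∉ FS)
    (t1 : T q y1 v1 ∧ ¬ P q y1 v1) (t2 : T q d1 b ∧ ¬ P q d1 b)
    (t3 : T q2 y1 b ∧ ¬ P q2 y1 b) (t4 : T q2 d1 v1 ∧ ¬ P q2 d1 v1)
    (t5 : T q y2 v2 ∧ ¬ P q y2 v2) (t6 : T q d2 a ∧ ¬ P q d2 a)
    (t7 : T q2' y2 a ∧ ¬ P q2' y2 a) (t8 : T q2' d2 v2 ∧ ¬ P q2' d2 v2)
    (t9 : T r y1 a ∧ ¬ P r y1 a) (t10 : T r y2 b ∧ ¬ P r y2 b) :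
    ∃ T' R QR QC QS, SwapOut T T' P FR FC FS r y1 y2 a b R QR QC QS := by
  have hqr : q ≠ r := fun h => hq (h ▸ hr)
  have hq2r : q2 ≠ r := fun h => hq2 (h ▸ hr)
  have hq2r' : q2' ≠ r := fun h => hq2' (h ▸ hr)
  have i1 : d1 ≠ y1 := fun h => hqq2 (hT.u1 (h ▸ t2.1) t3.1)
  have i2 : d2 ≠ y2 := fun h => hqq2' (hT.u1 (h ▸ t6.1) t7.1)
  have i3 : v1 ≠ b := fun h => hqq2 (hT.u1 (h ▸ t1.1) t3.1)
  have i4 : v2 ≠ a := fun h => hqq2' (hT.u1 (h ▸ t5.1) t7.1)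
  have i5 : v1 ≠ a := fun h => hqr (hT.u1 (h ▸ t1.1) t9.1)
  have i6 : v2 ≠ b := fun h => hqr (hT.u1 (h ▸ t5.1) t10.1)
  have i7 : d1 ≠ d2 := fun h => hab (hT.u3 t6.1 (h ▸ t2.1))
  refine ⟨_, _, {q, q2, q2', r, r}, {y1, y2, d1, d2, d2}, {v1, v2, a, b, b},
    swapOut_mk hT [(q,y1,v1),(q,d1,b),(q2,y1,b),(q2,d1,v1),(q,y2,v2),(q,d2,a),(q2',y2,a),(q2',d2,v2),(r,y1,a),(r,y2,b)]
    [(q,y1,a),(q,d1,v1),(q2,y1,v1),(q2,d1,b),(q,y2,b),(q,d2,v2),(q2',y2,v2),(q2',d2,a),(r,y1,b),(r,y2,a)]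
    _ _ _ ?_ ?_ (perm_of _ _ (a, a) [0, 1, 2, 3, 4, 5, 6, 7, 8, 9] 10 rfl (by decide) rfl) (perm_of _ _ (a, a) [5, 0, 3, 2, 1, 4, 7, 6, 9, 8] 10 rfl (by decide) rfl)
    (perm_of _ _ (a, a) [8, 3, 0, 1, 9, 7, 4, 5, 2, 6] 10 rfl (by decide) rfl) (by simp) (by simp) (by simp)
    (card5 _ _ _ _ _) (card5 _ _ _ _ _) (card5 _ _ _ _ _)
    (by simp) (by simp) (by simp) ?_ ?_ ?_ ?_⟩
  · simp only [List.nodup_cons, List.mem_cons, Prod.mk.injEq, List.not_mem_nil, or_false, not_or,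
      not_and, List.nodup_nil, and_true, not_false_eq_true]
    grind
  · simp only [List.forall_mem_cons, t1, t2, t3, t4, t5, t6, t7, t8, t9, t10]
    simp
  · intro x hx hxr
    simp only [Finset.mem_insert, Finset.mem_singleton, not_or]
    refine ⟨?_, ?_, ?_, hxr, hxr⟩ <;> rintro rfl <;> contradiction
  · intro x hx h1 h2
    simp only [Finset.mem_insert, Finset.mem_singleton, not_or]
    refine ⟨h1, h2, ?_, ?_, ?_⟩ <;> rintro rfl <;> contradiction
  · intro x hx h1 h2
    simp only [Finset.mem_insert, Finset.mem_singleton, not_or]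
    refine ⟨?_, ?_, h1, h2, h2⟩ <;> rintro rfl <;> contradiction
  · simp [hqr, hq2r, hq2r']

theorem mis_core {α : Type} {T P : α → α → α → Prop} (hT : Lat T) {FR FC FS : Finset α}
    {r y1 y2 a b q q' q2 q2' d1 d2 v1 v2 m : α} (hr : r ∈ FR)
    (hy : y1 ≠ y2) (hab : a ≠ b) (hq : q ∉ FR) (hq' : q' ∉ FR) (hq2 : q2 ∉ FR) (hq2' : q2' ∉ FR)
    (hqq' : q ≠ q') (hqq2 : q ≠ q2) (hqq2' : q' ≠ q2') (hq22 : q2 ≠ q2')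
    (hd1 : d1 ∉ FC) (hd2 : d2 ∉ FC) (hv1 : v1 ∉ FS)
    (hv2 : v2 ∉ FS) (hm : m ∉ FS)
    (t1 : T q y1 v1 ∧ ¬ P q y1 v1) (t2 : T q d1 b ∧ ¬ P q d1 b)
    (t3 : T q2 y1 b ∧ ¬ P q2 y1 b) (t4 : T q2 d1 v1 ∧ ¬ P q2 d1 v1)
    (t5 : T q' y2 v2 ∧ ¬ P q' y2 v2) (t6 : T q' d2 a ∧ ¬ P q' d2 a)
    (t7 : T q2' y2 a ∧ ¬ P q2' y2 a) (t8 : T q2' d2 v2 ∧ ¬ P q2' d2 v2)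
    (t9 : T r y1 a ∧ ¬ P r y1 a) (t10 : T r y2 b ∧ ¬ P r y2 b)
    (t11 : T q y2 m ∧ ¬ P q y2 m) (t12 : T q' y1 m ∧ ¬ P q' y1 m) :
    ∃ T' R QR QC QS, SwapOut T T' P FR FC FS r y1 y2 a b R QR QC QS := by
  have hqr : q ≠ r := fun h => hq (h ▸ hr)
  have hqr' : q' ≠ r := fun h => hq' (h ▸ hr)
  have hq2r : q2 ≠ r := fun h => hq2 (h ▸ hr)
  have hq2r' : q2' ≠ r := fun h => hq2' (h ▸ hr)
  have i1 : d1 ≠ y1 := fun h => hqq2 (hT.u1 (h ▸ t2.1) t3.1)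
  have i2 : d2 ≠ y2 := fun h => hqq2' (hT.u1 (h ▸ t6.1) t7.1)
  have i3 : v1 ≠ b := fun h => hqq2 (hT.u1 (h ▸ t1.1) t3.1)
  have i4 : v2 ≠ a := fun h => hqq2' (hT.u1 (h ▸ t5.1) t7.1)
  have i5 : v1 ≠ a := fun h => hqr (hT.u1 (h ▸ t1.1) t9.1)
  have i6 : v2 ≠ b := fun h => hqr' (hT.u1 (h ▸ t5.1) t10.1)
  have i7 : d1 ≠ y2 := fun h => hqr (hT.u1 (h ▸ t2.1) t10.1)
  have i8 : d2 ≠ y1 := fun h => hqr' (hT.u1 (h ▸ t6.1) t9.1)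
  have i9 : m ≠ a := fun h => hqr' (hT.u1 (h ▸ t12.1) t9.1)
  have i10 : m ≠ b := fun h => hqr (hT.u1 (h ▸ t11.1) t10.1)
  refine ⟨_, _, {q, q', q2, q2', r}, {y1, y2, d1, d2, d2}, {v1, v2, m, a, b},
    swapOut_mk hT [(q,y1,v1),(q,d1,b),(q2,y1,b),(q2,d1,v1),(q',y2,v2),(q',d2,a),(q2',y2,a),(q2',d2,v2),(r,y1,a),(r,y2,b),(q,y2,m),(q',y1,m)]
    [(q,y1,m),(q,d1,v1),(q2,y1,v1),(q2,d1,b),(q',y2,m),(q',d2,v2),(q2',y2,v2),(q2',d2,a),(r,y1,b),(r,y2,a),(q,y2,b),(q',y1,a)]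
    _ _ _ ?_ ?_ (perm_of _ _ (a, a) [0, 1, 2, 3, 4, 5, 6, 7, 8, 9, 10, 11] 12 rfl (by decide) rfl) (perm_of _ _ (a, a) [10, 0, 3, 2, 11, 4, 7, 6, 9, 8, 1, 5] 12 rfl (by decide) rfl)
    (perm_of _ _ (a, a) [11, 3, 0, 1, 10, 7, 4, 5, 2, 6, 9, 8] 12 rfl (by decide) rfl) (by simp) (by simp) (by simp)
    (card5 _ _ _ _ _) (card5 _ _ _ _ _) (card5 _ _ _ _ _)
    (by simp) (by simp) (by simp) ?_ ?_ ?_ ?_⟩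
  · simp only [List.nodup_cons, List.mem_cons, Prod.mk.injEq, List.not_mem_nil, or_false, not_or,
      not_and, List.nodup_nil, and_true, not_false_eq_true]
    grind
  · simp only [List.forall_mem_cons, t1, t2, t3, t4, t5, t6, t7, t8, t9, t10, t11, t12]
    simp
  · intro x hx hxr
    simp only [Finset.mem_insert, Finset.mem_singleton, not_or]
    refine ⟨?_, ?_, ?_, ?_, hxr⟩ <;> rintro rfl <;> contradiction
  · intro x hx h1 h2
    simp only [Finset.mem_insert, Finset.mem_singleton, not_or]
    refine ⟨h1, h2, ?_, ?_, ?_⟩ <;> rintro rfl <;> contradiction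
  · intro x hx h1 h2
    simp only [Finset.mem_insert, Finset.mem_singleton, not_or]
    refine ⟨?_, ?_, ?_, h1, h2⟩ <;> rintro rfl <;> contradiction
  · simp [hqr, hqr', hq2r, hq2r']

end LSQ

namespace LSQ
open scoped Classical

variable {α : Type} [Fintype α]


theorem cnt_inj (X : α → Prop) (g : α → α) (hg : ∀ a b, g a = g b → a = b) :
    cnt (fun q => X (g q)) ≤ cnt X := by
  apply Finset.card_le_card_of_injOn g
  · intro a ha; simpa using ha
  · intro a _ b _ h; exact hg a b h

theorem cnt_mem (F : Finset α) : cnt (fun q => q ∈ F) ≤ F.card := by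
  apply Finset.card_le_card
  intro a ha; simpa using ha

theorem cnt_C (B : α → α → α → Prop) (y : α) : cnt (fun q => ∃ v, B q y v) ≤ CL B y := by
  have : (Finset.univ.filter fun q => ∃ v, B q y v) ⊆
    (Finset.univ.filter fun p : α × α => B p.1 y p.2).image Prod.fst := by
    intro q hq
    simp only [Finset.mem_filter, Finset.mem_univ, true_and] at hq
    obtain ⟨v, hv⟩ := hq
    exact Finset.mem_image.mpr ⟨(q, v), by simpa using hv, rfl⟩
  have h2 := (Finset.card_le_card this).trans Finset.card_image_le
  unfold cnt CL
  refine le_trans (le_of_eq ?_) h2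
  congr

theorem cnt_S (B : α → α → α → Prop) (z : α) : cnt (fun q => ∃ v, B q v z) ≤ SL B z :=
  cnt_C (s23 B) z

theorem cnt_R (B : α → α → α → Prop) (x : α) : cnt (fun q => ∃ v, B x q v) ≤ RL B x :=
  cnt_C (s12 B) x

theorem cnt_two (X : α → Prop) (g : α → α) (hg : ∀ a b, g a = g b → a = b) (τ : α → Bool)
    (c : Bool) : cnt (fun q => τ q = c ∧ (X q ∨ (τ (g q) ≠ c ∧ X (g q)))) ≤ cnt X := by
  have h1 : cnt (fun q => τ q = c ∧ (X q ∨ (τ (g q) ≠ c ∧ X (g q)))) ≤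
      cnt (fun q => X q ∧ τ q = c) + cnt (fun q => X q ∧ ¬ τ q = c) := by
    refine le_trans ?_ (Nat.add_le_add_left (cnt_inj (fun q => X q ∧ ¬ τ q = c) g hg) _)
    unfold cnt
    refine le_trans (Finset.card_le_card ?_) (Finset.card_union_le _ _)
    intro q hq
    simp only [Finset.mem_filter, Finset.mem_univ, true_and, Finset.mem_union] at hq ⊢
    tauto
  refine h1.trans (le_of_eq ?_)
  unfold cnt
  have := Finset.card_filter_add_card_filter_not (s := Finset.univ.filter X) (fun q => τ q = c)
  rw [Finset.filter_filter, Finset.filter_filter] at this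
  convert this

theorem pick (Y : α → Prop) (K : List (α → Prop)) (h : (K.map cnt).sum < cnt Y) :
    ∃ q, Y q ∧ ∀ X ∈ K, ¬ X q := by
  induction K generalizing Y with
  | nil =>
    simp only [List.map_nil, List.sum_nil, cnt, Finset.card_pos] at h
    obtain ⟨q, hq⟩ := h
    exact ⟨q, by simpa using hq, by simp⟩
  | cons X K ih =>
    have h2 : cnt Y ≤ cnt X + cnt (fun q => Y q ∧ ¬ X q) := by
      unfold cnt
      refine le_trans (Finset.card_le_card ?_) (Finset.card_union_le _ _)
      intro q hq
      simp only [Finset.mem_filter, Finset.mem_univ, true_and, Finset.mem_union] at hq ⊢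
      tauto
    simp only [List.map_cons, List.sum_cons] at h
    obtain ⟨q, hq, hK⟩ := ih (fun q => Y q ∧ ¬ X q) (by omega)
    refine ⟨q, hq.1, ?_⟩
    simp only [List.forall_mem_cons]
    exact ⟨hq.2, hK⟩

theorem swap_match {M D T B P : α → α → α → Prop} {τ : α → Bool} {k : ℕ} (hF : Frame M D τ k)
    (hT : Lat T) (hDB : ∀ x y z, D x y z → B x y z) {FR FC FS : Finset α}
    {r y1 y2 a b q2 q2' : α} (hr : r ∈ FR) (hy : y1 ≠ y2) (hab : a ≠ b)
    (t9 : T r y1 a ∧ ¬ P r y1 a) (t10 : T r y2 b ∧ ¬ P r y2 b)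
    (m1 : M q2 y1 b) (b1 : ¬ B q2 y1 b) (f1 : q2 ∉ FR)
    (m2 : M q2' y2 a) (b2 : ¬ B q2' y2 a) (f2 : q2' ∉ FR)
    (hgood : ∀ x y z, M x y z → ¬ B x y z → x ∉ FR → T x y z ∧ ¬ P x y z)
    (hc : CL B y1 + CL B y2 + SL B a + SL B b + RL B q2 + RL B q2' + FR.card + 3 * FC.card
      + 3 * FS.card + 4 < k) (hτ : τ q2 = τ q2') :
    ∃ T' R QR QC QS, SwapOut T T' P FR FC FS r y1 y2 a b R QR QC QS := by
  have hM := hF.lat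
  choose gd1 hgd1 using fun q => hM.e2 q b
  choose gv1 hgv1 using fun q => hM.e3 q y1
  choose gd2 hgd2 using fun q => hM.e2 q a
  choose gv2 hgv2 using fun q => hM.e3 q y2
  have id1 : ∀ q q', gd1 q = gd1 q' → q = q' := fun q q' h => hM.u1 (hgd1 q) (h ▸ hgd1 q')
  have id2 : ∀ q q', gd2 q = gd2 q' → q = q' := fun q q' h => hM.u1 (hgd2 q) (h ▸ hgd2 q')
  have iv1 : ∀ q q', gv1 q = gv1 q' → q = q' := fun q q' h => hM.u1 (hgv1 q) (h ▸ hgv1 q')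
  have iv2 : ∀ q q', gv2 q = gv2 q' → q = q' := fun q q' h => hM.u1 (hgv2 q) (h ▸ hgv2 q')
  obtain ⟨q, hq, hK⟩ := pick (fun q => τ q = !τ q2)
    [fun q => ∃ v, B q y1 v, fun q => ∃ v, B q y2 v, fun q => ∃ v, B q v a, fun q => ∃ v, B q v b,
     fun q => ∃ v, B q2 (gd1 q) v, fun q => ∃ v, B q2' (gd2 q) v, fun q => q ∈ FR,
     fun q => gd1 q ∈ FC, fun q => gd2 q ∈ FC, fun q => gv1 q ∈ FS, fun q => gv2 q ∈ FS] (by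
      have h0 := hF.big (!τ q2)
      have h1 := cnt_C B y1
      have h2 := cnt_C B y2
      have h3 := cnt_S B a
      have h4 := cnt_S B b
      have h5 := (cnt_inj (fun d => ∃ v, B q2 d v) gd1 id1).trans (cnt_R B q2)
      have h6 := (cnt_inj (fun d => ∃ v, B q2' d v) gd2 id2).trans (cnt_R B q2')
      have h7 := cnt_mem FR
      have h8 := (cnt_inj _ gd1 id1).trans (cnt_mem FC)
      have h9 := (cnt_inj _ gd2 id2).trans (cnt_mem FC)
      have h10 := (cnt_inj _ gv1 iv1).trans (cnt_mem FS)
      have h11 := (cnt_inj _ gv2 iv2).trans (cnt_mem FS)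
      simp only [List.map_cons, List.map_nil, List.sum_cons, List.sum_nil]
      omega)
  simp only [List.forall_mem_cons, not_exists] at hK
  obtain ⟨k1, k2, k3, k4, k5, k6, k7, k8, k9, k10, k11, -⟩ := hK
  have ne1 : τ q ≠ τ q2 := by rw [hq]; cases τ q2 <;> simp
  have ne2 : τ q ≠ τ q2' := hτ ▸ ne1
  have nD : ∀ {x y z}, ¬ B x y z → ¬ D x y z := fun h h' => h (hDB _ _ _ h')
  have M1 := hF.flip q q2 y1 (gd1 q) b (gv1 q) m1 (hgd1 q) (hgv1 q) (nD b1) (nD (k4 _)) (nD (k1 _)) ne1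
    (Or.inl fun v => nD (k5 v))
  have M2 := hF.flip q q2' y2 (gd2 q) a (gv2 q) m2 (hgd2 q) (hgv2 q) (nD b2) (nD (k3 _)) (nD (k2 _)) ne2
    (Or.inl fun v => nD (k6 v))
  exact match_core hT hr hy hab k7 f1 f2 (fun h => ne1 (congrArg τ h)) (fun h => ne2 (congrArg τ h))
    k8 k9 k10 k11 (hgood _ _ _ (hgv1 q) (k1 _) k7) (hgood _ _ _ (hgd1 q) (k4 _) k7)
    (hgood _ _ _ m1 b1 f1) (hgood _ _ _ M1 (k5 _) f1) (hgood _ _ _ (hgv2 q) (k2 _) k7)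
    (hgood _ _ _ (hgd2 q) (k3 _) k7)
    (hgood _ _ _ m2 b2 f2) (hgood _ _ _ M2 (k6 _) f2) t9 t10

theorem swap_mis {M D T B P : α → α → α → Prop} {τ : α → Bool} {k : ℕ} (hF : Frame M D τ k)
    (hT : Lat T) (hDB : ∀ x y z, D x y z → B x y z) {FR FC FS : Finset α}
    {r y1 y2 a b q2 q2' : α} (hr : r ∈ FR) (hy : y1 ≠ y2) (hab : a ≠ b)
    (t9 : T r y1 a ∧ ¬ P r y1 a) (t10 : T r y2 b ∧ ¬ P r y2 b)
    (m1 : M q2 y1 b) (b1 : ¬ B q2 y1 b) (f1 : q2 ∉ FR)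
    (m2 : M q2' y2 a) (b2 : ¬ B q2' y2 a) (f2 : q2' ∉ FR)
    (hgood : ∀ x y z, M x y z → ¬ B x y z → x ∉ FR → T x y z ∧ ¬ P x y z)
    (hc : CL B y1 + CL B y2 + SL B a + SL B b + RL B q2 + RL B q2' + FR.card + 3 * FC.card
      + 3 * FS.card + 4 < k) (hτ : τ q2 ≠ τ q2') (hτy : τ y1 ≠ τ y2) :
    ∃ T' R QR QC QS, SwapOut T T' P FR FC FS r y1 y2 a b R QR QC QS := by
  have hM := hF.lat
  have nD : ∀ {x y z}, ¬ B x y z → ¬ D x y z := fun h h' => h (hDB _ _ _ h')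
  choose gd1 hgd1 using fun q => hM.e2 q b
  choose gv1 hgv1 using fun q => hM.e3 q y1
  choose gm hgm using fun q => hM.e3 q y2
  choose g hg using fun q => hM.e1 y1 (gm q)
  choose gd2 hgd2 using fun q => hM.e2 (g q) a
  choose gv2 hgv2 using fun q => hM.e3 (g q) y2
  have id1 : ∀ q q', gd1 q = gd1 q' → q = q' := fun q q' h => hM.u1 (hgd1 q) (h ▸ hgd1 q')
  have iv1 : ∀ q q', gv1 q = gv1 q' → q = q' := fun q q' h => hM.u1 (hgv1 q) (h ▸ hgv1 q')
  have im : ∀ q q', gm q = gm q' → q = q' := fun q q' h => hM.u1 (hgm q) (h ▸ hgm q')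
  have ig : ∀ q q', g q = g q' → q = q' := fun q q' h => im _ _ (hM.u3 (hg q) (h ▸ hg q'))
  have id2 : ∀ q q', gd2 q = gd2 q' → q = q' :=
    fun q q' h => ig _ _ (hM.u1 (hgd2 q) (h ▸ hgd2 q'))
  have iv2 : ∀ q q', gv2 q = gv2 q' → q = q' :=
    fun q q' h => ig _ _ (hM.u1 (hgv2 q) (h ▸ hgv2 q'))
  obtain ⟨q, hq, hK⟩ := pick (fun q => τ q = !τ q2)
    [fun q => τ q = (!τ q2) ∧ ((∃ v, B q y1 v) ∨ (τ (g q) ≠ (!τ q2) ∧ ∃ v, B (g q) y1 v)),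
     fun q => τ q = (!τ q2) ∧ ((∃ v, B q y2 v) ∨ (τ (g q) ≠ (!τ q2) ∧ ∃ v, B (g q) y2 v)),
     fun q => τ q = (!τ q2) ∧ (q ∈ FR ∨ (τ (g q) ≠ (!τ q2) ∧ g q ∈ FR)),
     fun q => ∃ v, B (g q) v a, fun q => ∃ v, B q v b,
     fun q => ∃ v, B q2 (gd1 q) v, fun q => ∃ v, B q2' (gd2 q) v,
     fun q => gd1 q ∈ FC, fun q => gd2 q ∈ FC, fun q => gv1 q ∈ FS, fun q => gv2 q ∈ FS,
     fun q => gm q ∈ FS, fun q => ∃ v, D q y2 v, fun q => ∃ v, D (g q) y1 v] (by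
      have h0 := hF.big (!τ q2)
      have h1 := (cnt_two (fun q => ∃ v, B q y1 v) g ig τ (!τ q2)).trans (cnt_C B y1)
      have h2 := (cnt_two (fun q => ∃ v, B q y2 v) g ig τ (!τ q2)).trans (cnt_C B y2)
      have h7 := (cnt_two (fun q => q ∈ FR) g ig τ (!τ q2)).trans (cnt_mem FR)
      have h3 := (cnt_inj (fun q => ∃ v, B q v a) g ig).trans (cnt_S B a)
      have h4 := cnt_S B b
      have h5 := (cnt_inj (fun d => ∃ v, B q2 d v) gd1 id1).trans (cnt_R B q2)
      have h6 := (cnt_inj (fun d => ∃ v, B q2' d v) gd2 id2).trans (cnt_R B q2')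
      have h8 := (cnt_inj _ gd1 id1).trans (cnt_mem FC)
      have h9 := (cnt_inj _ gd2 id2).trans (cnt_mem FC)
      have h10 := (cnt_inj _ gv1 iv1).trans (cnt_mem FS)
      have h11 := (cnt_inj _ gv2 iv2).trans (cnt_mem FS)
      have h12 := (cnt_inj _ gm im).trans (cnt_mem FS)
      have h13 := (cnt_C D y2).trans (hF.ld _ _ _ m2 (nD b2)).2.1
      have h14 := ((cnt_inj (fun q => ∃ v, D q y1 v) g ig).trans (cnt_C D y1)).trans
        (hF.ld _ _ _ m1 (nD b1)).2.1
      simp only [List.map_cons, List.map_nil, List.sum_cons, List.sum_nil]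
      omega)
  simp only [List.forall_mem_cons] at hK
  obtain ⟨k1, k2, k7, k3, k4, k5, k6, k8, k9, k10, k11, k12, k13, k14, -⟩ := hK
  have p1 := hF.par _ _ _ (hgm q) (fun h => k13 ⟨_, h⟩)
  have p2 := hF.par _ _ _ (hg q) (fun h => k14 ⟨_, h⟩)
  have hgq : τ (g q) ≠ !τ q2 := by
    revert p1 p2 hq hτy
    cases τ q <;> cases τ (g q) <;> cases τ q2 <;> cases τ y1 <;> cases τ y2 <;>
      cases τ (gm q) <;> simp
  simp only [not_and, not_or, not_exists] at k1 k2 k7 k3 k4 k5 k6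
  obtain ⟨k1, k1'⟩ := k1 hq
  obtain ⟨k2, k2'⟩ := k2 hq
  obtain ⟨k7, k7'⟩ := k7 hq
  replace k1' := k1' hgq
  replace k2' := k2' hgq
  replace k7' := k7' hgq
  have ne1 : τ q ≠ τ q2 := by rw [hq]; cases τ q2 <;> simp
  have ne2 : τ (g q) ≠ τ q2' := by
    revert hgq hτ
    cases τ (g q) <;> cases τ q2 <;> cases τ q2' <;> simp
  have ne3 : τ q ≠ τ (g q) := by rw [hq]; exact hgq.symm
  have M1 := hF.flip q q2 y1 (gd1 q) b (gv1 q) m1 (hgd1 q) (hgv1 q) (nD b1) (nD (k4 _)) (nD (k1 _)) ne1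
    (Or.inl fun v => nD (k5 v))
  have M2 := hF.flip (g q) q2' y2 (gd2 q) a (gv2 q) m2 (hgd2 q) (hgv2 q) (nD b2) (nD (k3 _)) (nD (k2' _)) ne2
    (Or.inl fun v => nD (k6 v))
  exact mis_core hT hr hy hab k7 k7' f1 f2 (fun h => ne3 (congrArg τ h))
    (fun h => ne1 (congrArg τ h)) (fun h => ne2 (congrArg τ h)) (fun h => hτ (congrArg τ h))
    k8 k9 k10 k11 k12 (hgood _ _ _ (hgv1 q) (k1 _) k7) (hgood _ _ _ (hgd1 q) (k4 _) k7)
    (hgood _ _ _ m1 b1 f1) (hgood _ _ _ M1 (k5 _) f1) (hgood _ _ _ (hgv2 q) (k2' _) k7')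
    (hgood _ _ _ (hgd2 q) (k3 _) k7')
    (hgood _ _ _ m2 b2 f2) (hgood _ _ _ M2 (k6 _) f2) t9 t10
    (hgood _ _ _ (hgm q) (k2 _) k7) (hgood _ _ _ (hg q) (k1' _) k7')

theorem swap {M D T B P : α → α → α → Prop} {τ : α → Bool} {k : ℕ} (hF : Frame M D τ k)
    (hT : Lat T) (hDB : ∀ x y z, D x y z → B x y z) {FR FC FS : Finset α}
    {r y1 y2 a b q2 q2' : α} (hr : r ∈ FR) (hy : y1 ≠ y2) (hab : a ≠ b)
    (t9 : T r y1 a ∧ ¬ P r y1 a) (t10 : T r y2 b ∧ ¬ P r y2 b)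
    (m1 : M q2 y1 b) (b1 : ¬ B q2 y1 b) (f1 : q2 ∉ FR)
    (m2 : M q2' y2 a) (b2 : ¬ B q2' y2 a) (f2 : q2' ∉ FR)
    (hgood : ∀ x y z, M x y z → ¬ B x y z → x ∉ FR → T x y z ∧ ¬ P x y z)
    (hc : CL B y1 + CL B y2 + SL B a + SL B b + RL B q2 + RL B q2' + FR.card + 3 * FC.card
      + 3 * FS.card + 4 < k) :
    ∃ T' R QR QC QS, SwapOut T T' P FR FC FS r y1 y2 a b R QR QC QS := by
  by_cases hτ : τ q2 = τ q2'
  · exact swap_match hF hT hDB hr hy hab t9 t10 m1 b1 f1 m2 b2 f2 hgood hc hτ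
  by_cases hτy : τ y1 = τ y2
  swap
  · exact swap_mis hF hT hDB hr hy hab t9 t10 m1 b1 f1 m2 b2 f2 hgood hc hτ hτy
  have hτb : τ b ≠ τ a := by
    have p1 := hF.par _ _ _ m1 (fun h => b1 (hDB _ _ _ h))
    have p2 := hF.par _ _ _ m2 (fun h => b2 (hDB _ _ _ h))
    revert p1 p2 hτ hτy
    cases τ q2 <;> cases τ q2' <;> cases τ y1 <;> cases τ y2 <;> cases τ a <;> cases τ b <;> simp
  obtain ⟨T', R, QR, QC, QS, h⟩ := swap_mis (P := s23 P) (B := s23 B) (T := s23 T)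
    (FR := FR) (FC := FS) (FS := FC) (a := y2) (b := y1) (y1 := b) (y2 := a) (r := r)
    hF.s23 hT.s23
    (fun x y z h => hDB _ _ _ h) hr hab.symm hy.symm t10 t9 m1 b1 f1 m2 b2 f2
    (fun x y z => hgood x z y) (by
      rw [CL_s23, CL_s23, SL_s23, SL_s23, RL_s23, RL_s23]; omega) hτ hτb
  refine ⟨s23 T', R.map (fun p => (p.1, p.2.2, p.2.1)), QR, QS, QC, ?_⟩
  refine ⟨h.lat.s23, h.n1, h.n2, by simpa using h.len, ?_, h.cR, h.cS, h.cC, ?_, ?_, ?_,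
    h.avR, ?_, ?_, ?_⟩
  · intro x y z h1 h2
    obtain ⟨h3, h4⟩ := h.rem x z y h1 h2
    exact ⟨List.mem_map.mpr ⟨_, h3, rfl⟩, h4⟩
  · intro x y z hx; exact h.offR x z y hx
  · intro x y z hx; exact h.offS x z y hx
  · intro x y z hx; exact h.offC x z y hx
  · intro y hy h1 h2; exact h.avS y hy h2 h1
  · intro y hy h1 h2; exact h.avC y hy h2 h1
  · intro y z h0 h1 h2
    exact h.stay z y h0 (fun e => h2 (hT.u2 (e ▸ h0) t10.1)) (fun e => h1 (hT.u2 (e ▸ h0) t9.1))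

end LSQ

namespace LSQ
open scoped Classical

variable {α : Type} [Fintype α]

theorem swapS {M D T B P : α → α → α → Prop} {τ : α → Bool} {k : ℕ} (hF : Frame M D τ k)
    (hT : Lat T) (hDB : ∀ x y z, D x y z → B x y z) {FR FC FS : Finset α}
    {t r1 r3 c3 c1 z z' : α} (ht : t ∈ FS) (hr : r1 ≠ r3) (hc : c3 ≠ c1)
    (t9 : T r1 c3 t ∧ ¬ P r1 c3 t) (t10 : T r3 c1 t ∧ ¬ P r3 c1 t)
    (m1 : M r1 c1 z) (b1 : ¬ B r1 c1 z) (f1 : z ∉ FS)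
    (m2 : M r3 c3 z') (b2 : ¬ B r3 c3 z') (f2 : z' ∉ FS)
    (hgood : ∀ x y z, M x y z → ¬ B x y z → z ∉ FS → T x y z ∧ ¬ P x y z)
    (hk : RL B r1 + RL B r3 + CL B c3 + CL B c1 + SL B z + SL B z' + FS.card + 3 * FR.card
      + 3 * FC.card + 4 < k) :
    ∃ T' R QR QC QS, SwapOut (cyc T) (cyc T') (cyc P) FS FR FC t r1 r3 c3 c1 R QS QR QC := by
  obtain ⟨T', R, QS, QR, QC, h⟩ := swap (FR := FS) (FC := FR) (FS := FC) (P := cyc P) (B := cyc B)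
    hF.cyc hT.cyc (fun x y z => hDB y z x) ht hr hc
    t9 t10 m1 b1 f1 m2 b2 f2 (fun x y z => hgood y z x) (by
      rw [CL_cyc, CL_cyc, SL_cyc, SL_cyc, RL_cyc, RL_cyc]; exact hk)
  exact ⟨fun x y z => T' z x y, R, QR, QC, QS, h⟩

theorem swapC {M D T B P : α → α → α → Prop} {τ : α → Bool} {k : ℕ} (hF : Frame M D τ k)
    (hT : Lat T) (hDB : ∀ x y z, D x y z → B x y z) {FR FC FS : Finset α}
    {c r1 r4 w x e e' : α} (ht : c ∈ FC) (hr : r1 ≠ r4) (hc : w ≠ x)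
    (t9 : T r1 c w ∧ ¬ P r1 c w) (t10 : T r4 c x ∧ ¬ P r4 c x)
    (m1 : M r1 e x) (b1 : ¬ B r1 e x) (f1 : e ∉ FC)
    (m2 : M r4 e' w) (b2 : ¬ B r4 e' w) (f2 : e' ∉ FC)
    (hgood : ∀ x y z, M x y z → ¬ B x y z → y ∉ FC → T x y z ∧ ¬ P x y z)
    (hk : RL B r1 + RL B r4 + SL B w + SL B x + CL B e + CL B e' + FC.card + 3 * FR.card
      + 3 * FS.card + 4 < k) :
    ∃ T' R QR QC QS, SwapOut (s12 T) (s12 T') (s12 P) FC FR FS c r1 r4 w x R QC QR QS := by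
  obtain ⟨T', R, QC, QR, QS, h⟩ := swap (FR := FC) (FC := FR) (FS := FS) (P := s12 P) (B := s12 B)
    hF.s12 hT.s12 (fun x y z => hDB y x z) ht hr hc
    t9 t10 m1 b1 f1 m2 b2 f2 (fun x y z => hgood y x z) (by
      rw [CL_s12, CL_s12, SL_s12, SL_s12, RL_s12, RL_s12]; exact hk)
  exact ⟨fun x y z => T' y x z, R, QR, QC, QS, h⟩

theorem c1u {α : Type} (s t : Finset α) (n m : ℕ) (h : s.card ≤ n) (h' : t.card ≤ m) :
    (s ∪ t).card ≤ n + m := (Finset.card_union_le _ _).trans (Nat.add_le_add h h')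

theorem card8 {α : Type} (l : List α) : l.toFinset.card ≤ l.length := List.toFinset_card_le l

theorem core_nodup {α : Type} {r c s t c' r' r1 c1 c2 x y : α} (hr : r' ≠ r) (n1 : r1 ≠ r)
    (n2 : r1 ≠ r') (hc : c' ≠ c) (n4 : c1 ≠ c) (n5 : c1 ≠ c') (n6 : c2 ≠ c) (n7 : c2 ≠ c')
    (n8 : c1 ≠ c2) : [(r,c,t),(r,c',s),(r,c1,x),(r',c,s),(r',c2,y),(r1,c,y),(r1,c1,t),(r1,c',x),
      (r1,c2,s)].Nodup := by
  simp only [List.nodup_cons, List.mem_cons, Prod.mk.injEq, List.not_mem_nil, or_false, not_or,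
    not_and, List.nodup_nil, and_true, not_false_eq_true]
  grind

set_option maxHeartbeats 4000000 in
theorem step_core {M D T B P : α → α → α → Prop} {τ : α → Bool} {k : ℕ} (hF : Frame M D τ k)
    (hT : Lat T) (hDB : ∀ x y z, D x y z → B x y z)
    (hgood : ∀ x y z, M x y z → ¬ B x y z → T x y z ∧ ¬ P x y z)
    (hP2 : ∀ x y y' z, P x y z → P x y' z → y = y')
    (hP1 : ∀ x x' y z, P x y z → P x' y z → x = x')
    (hP3 : ∀ x y z z', P x y z → P x y z' → z = z')
    {r c s t c' r' r1 c1 c2 x y c3 r3 w r4 c6 r6 w' c5 zA zA' zE zE' e e' p p' : α}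
    (hPs : P r c s) (hnT : ¬ T r c s) (T1 : T r c t) (T2 : T r c' s) (T3 : T r' c s)
    (Tx : T r c1 x) (Ty : T r1 c y) (Tc3 : T r1 c3 t) (Tr3 : T r3 c1 t) (Tw : T r1 c' w)
    (Tr4 : T r4 c' x) (Tc6 : T r1 c6 s) (Tr6 : T r6 c2 s) (Tw' : T r' c2 w') (Tc5 : T r' c5 y)
    (MA : M r1 c1 zA) (MA' : M r3 c3 zA') (ME : M r1 c2 zE) (ME' : M r6 c6 zE')
    (Me : M r1 e x) (Me' : M r4 e' w) (Mp : M p c2 y) (Mp' : M p' c5 w')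
    (BA : ¬ B r1 c1 zA) (BA' : ¬ B r3 c3 zA') (BE : ¬ B r1 c2 zE) (BE' : ¬ B r6 c6 zE')
    (Be : ¬ B r1 e x) (Be' : ¬ B r4 e' w) (Bp : ¬ B p c2 y) (Bp' : ¬ B p' c5 w')
    (Px : ¬ P r c1 x) (Py : ¬ P r1 c y) (Pc3 : ¬ P r1 c3 t) (Pr3 : ¬ P r3 c1 t) (Pw : ¬ P r1 c' w)
    (Pr4 : ¬ P r4 c' x) (Pc6 : ¬ P r1 c6 s) (Pr6 : ¬ P r6 c2 s) (Pw' : ¬ P r' c2 w')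
    (Pc5 : ¬ P r' c5 y)
    (n1 : r1 ≠ r) (n2 : r1 ≠ r') (n3 : c5 ≠ c') (n4 : c1 ≠ c) (n5 : c1 ≠ c') (n6 : c2 ≠ c)
    (n7 : c2 ≠ c') (n8 : c1 ≠ c2) (n10 : c3 ≠ c1) (n11 : c6 ≠ c2) (n12 : w ≠ x)
    (n13 : c5 ≠ c2) (n14 : w ≠ t) (n15 : w' ≠ t)
    (hzA : zA ∉ [t, s, x, y, w, w', zE, zE'].toFinset)
    (hzA' : zA' ∉ [t, s, x, y, w, w', zE, zE'].toFinset)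
    (hzE : zE ∉ [t, s, x, y, w, w'].toFinset)
    (hzE' : zE' ∉ [t, s, x, y, w, w'].toFinset)
    (he : e ∉ [c, c', c1, c2, c5, c3, c6].toFinset)
    (he' : e' ∉ [c, c', c1, c2, c5, c3, c6].toFinset)
    (hp : p ∉ [r, r1, r', r3, r4, r6].toFinset)
    (hp' : p' ∉ [r, r1, r', r3, r4, r6].toFinset)
    (kA : RL B r1 + RL B r3 + CL B c3 + CL B c1 + SL B zA + SL B zA' + 27 < k)
    (kE : RL B r1 + RL B r6 + CL B c6 + CL B c2 + SL B zE + SL B zE' + 27 < k)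
    (kC : RL B r1 + RL B r4 + SL B w + SL B x + CL B e + CL B e' + 27 < k)
    (kF : CL B c2 + CL B c5 + SL B w' + SL B y + RL B p + RL B p' + 27 < k) :
    ∃ T', Lat T' ∧ T' r c s ∧ (∀ x y z, P x y z → T x y z → T' x y z) ∧
      ∃ R : List (α × α × α), R.length ≤ 57 ∧ ∀ x y z, T x y z → ¬ T' x y z → (x, y, z) ∈ R := by
  simp only [List.mem_toFinset, List.mem_cons, List.not_mem_nil, or_false, not_or] at he he' hp hp'
  obtain ⟨e1, e2, e3, e4, e5, e6, e7⟩ := he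
  obtain ⟨e1', e2', e3', e4', e5', e6', e7'⟩ := he'
  obtain ⟨p1, p2, p3, p4, p5, p6⟩ := hp
  obtain ⟨p1', p2', p3', p4', p5', p6'⟩ := hp'
  -- basic distinctness
  have hts : t ≠ s := fun h => hnT (h ▸ T1)
  have hcc' : c' ≠ c := fun h => hnT (h ▸ T2)
  have hrr' : r' ≠ r := fun h => hnT (h ▸ T3)
  have hxt : x ≠ t := fun h => n4 (hT.u2 (h ▸ Tx) T1)
  have hxs : x ≠ s := fun h => n5 (hT.u2 (h ▸ Tx) T2)
  have hyt : y ≠ t := fun h => n1 (hT.u1 (h ▸ Ty) T1)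
  have hys : y ≠ s := fun h => n2 (hT.u1 (h ▸ Ty) T3)
  have hws : w ≠ s := fun h => n1 (hT.u1 (h ▸ Tw) T2)
  have hw's : w' ≠ s := fun h => n6 (hT.u2 (h ▸ Tw') T3)
  have hr13 : r1 ≠ r3 := fun h => n10 (hT.u2 Tc3 (h ▸ Tr3))
  have hr16 : r1 ≠ r6 := fun h => n11 (hT.u2 Tc6 (h ▸ Tr6))
  have hr14 : r1 ≠ r4 := fun h => n12 (hT.u3 Tw (h ▸ Tr4))
  have hr3 : r ≠ r3 := fun h => n4 (hT.u2 Tr3 (h ▸ T1))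
  have hr6 : r ≠ r6 := fun h => n7 (hT.u2 Tr6 (h ▸ T2))
  have hr'6 : r' ≠ r6 := fun h => n6 (hT.u2 Tr6 (h ▸ T3))
  have hr4 : r ≠ r4 := fun h => hxs (hT.u3 Tr4 (h ▸ T2))
  have hc5 : c ≠ c5 := fun h => hys (hT.u3 Tc5 (h ▸ T3))
  have hw'y : w' ≠ y := fun h => n13 (hT.u2 Tc5 (h ▸ Tw'))
  -- swap A
  obtain ⟨TA, RA, QRA, QCA, QSA, hA⟩ := swapS (P := P) (FR := {p, p'}) (FC := {e, e'}) hF hT hDB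
    (FS := [t, s, x, y, w, w', zE, zE'].toFinset) (by simp) hr13 n10 ⟨Tc3, Pc3⟩ ⟨Tr3, Pr3⟩
    MA BA hzA MA' BA' hzA' (fun x y z h1 h2 _ => hgood x y z h1 h2) (by
      have h1 := card8 [t, s, x, y, w, w', zE, zE']
      have h2 : ({p, p'} : Finset α).card ≤ 2 := Finset.card_le_two
      have h3 : ({e, e'} : Finset α).card ≤ 2 := Finset.card_le_two
      simp only [List.length_cons, List.length_nil] at h1
      omega)
  have latA : Lat TA := hA.lat.cyc.cyc
  have sA : ∀ {a b z}, z ∈ [t, s, x, y, w, w', zE, zE'].toFinset → z ≠ t → T a b z → TA a b z :=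
    fun {a b z} h1 h2 h3 => (hA.offR z a b (hA.avR z h1 h2)).mpr h3
  have A1 : TA r1 c1 t := hA.n1
  have A2 : TA r c t := hA.stay r c T1 (Ne.symm n1) hr3
  have A3 : TA r c' s := sA (by simp) hts.symm T2
  have A4 : TA r c1 x := sA (by simp) hxt Tx
  have A5 : TA r' c s := sA (by simp) hts.symm T3
  have A6 : TA r1 c y := sA (by simp) hyt Ty
  have A7 : TA r1 c' w := sA (by simp) n14 Tw
  have A8 : TA r4 c' x := sA (by simp) hxt Tr4
  have A9 : TA r1 c6 s := sA (by simp) hts.symm Tc6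
  have A10 : TA r6 c2 s := sA (by simp) hts.symm Tr6
  have A11 : TA r' c2 w' := sA (by simp) n15 Tw'
  have A12 : TA r' c5 y := sA (by simp) hyt Tc5
  have zEA : zE ∉ QSA := hA.avR zE (by simp) (fun h => hzE (by simp [h]))
  have zEA' : zE' ∉ QSA := hA.avR zE' (by simp) (fun h => hzE' (by simp [h]))
  have eA : e ∉ QCA := hA.avS e (by simp) (by assumption) (by assumption)
  have eA' : e' ∉ QCA := hA.avS e' (by simp) (by assumption) (by assumption)
  have pA : p ∉ QRA := hA.avC p (by simp) (by assumption) (by assumption)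
  have pA' : p' ∉ QRA := hA.avC p' (by simp) (by assumption) (by assumption)
  have offA1 : ∀ a b z, a ∉ QRA → (TA a b z ↔ T a b z) := fun a b z h => hA.offC z a b h
  have offA2 : ∀ a b z, b ∉ QCA → (TA a b z ↔ T a b z) := fun a b z h => hA.offS z a b h
  have offA3 : ∀ a b z, z ∉ QSA → (TA a b z ↔ T a b z) := fun a b z h => hA.offR z a b h
  -- swap E
  obtain ⟨TE, RE, QRE, QCE, QSE, hE⟩ := swapS (P := P) (FR := {p, p'}) (FC := {e, e'}) hF latA hDB
    (FS := [t, s, x, y, w, w'].toFinset ∪ QSA) (by simp) hr16 n11 ⟨A9, Pc6⟩ ⟨A10, Pr6⟩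
    ME BE (by rw [Finset.mem_union, not_or]; exact ⟨hzE, zEA⟩) ME' BE'
    (by rw [Finset.mem_union, not_or]; exact ⟨hzE', zEA'⟩)
    (fun x y z h1 h2 h3 => by
      have h4 : z ∉ QSA := fun h => h3 (Finset.mem_union_right _ h)
      rw [offA3 _ _ _ h4]
      exact hgood x y z h1 h2) (by
      have h1 := c1u _ _ _ _ (card8 [t, s, x, y, w, w']) hA.cR
      have h2 : ({p, p'} : Finset α).card ≤ 2 := Finset.card_le_two
      have h3 : ({e, e'} : Finset α).card ≤ 2 := Finset.card_le_two
      simp only [List.length_cons, List.length_nil] at h1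
      omega)
  have latE : Lat TE := hE.lat.cyc.cyc
  have sE : ∀ {a b z}, z ∈ [t, s, x, y, w, w'].toFinset → z ≠ s → TA a b z → TE a b z :=
    fun {a b z} h1 h2 h3 => (hE.offR z a b (hE.avR z (Finset.mem_union_left _ h1) h2)).mpr h3
  have E0 : TE r1 c2 s := hE.n1
  have E1 : TE r1 c1 t := sE (by simp) hts A1
  have E2 : TE r c t := sE (by simp) hts A2
  have E3 : TE r c' s := hE.stay r c' A3 (Ne.symm n1) hr6
  have E4 : TE r c1 x := sE (by simp) hxs A4
  have E5 : TE r' c s := hE.stay r' c A5 (Ne.symm n2) hr'6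
  have E6 : TE r1 c y := sE (by simp) hys A6
  have E7 : TE r1 c' w := sE (by simp) hws A7
  have E8 : TE r4 c' x := sE (by simp) hxs A8
  have E11 : TE r' c2 w' := sE (by simp) hw's A11
  have E12 : TE r' c5 y := sE (by simp) hys A12
  have eE : e ∉ QCE := hE.avS e (by simp) (by assumption) (by assumption)
  have eE' : e' ∉ QCE := hE.avS e' (by simp) (by assumption) (by assumption)
  have pE : p ∉ QRE := hE.avC p (by simp) (by assumption) (by assumption)
  have pE' : p' ∉ QRE := hE.avC p' (by simp) (by assumption) (by assumption)
  have offE1 : ∀ a b z, a ∉ QRE → (TE a b z ↔ TA a b z) := fun a b z h => hE.offC z a b h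
  have offE2 : ∀ a b z, b ∉ QCE → (TE a b z ↔ TA a b z) := fun a b z h => hE.offS z a b h
  -- swap C
  have eC : e ∉ [c, c', c1, c2, c5].toFinset := by
    simp only [List.mem_toFinset, List.mem_cons, List.not_mem_nil, or_false, not_or]
    exact ⟨e1, e2, e3, e4, e5⟩
  have eC' : e' ∉ [c, c', c1, c2, c5].toFinset := by
    simp only [List.mem_toFinset, List.mem_cons, List.not_mem_nil, or_false, not_or]
    exact ⟨e1', e2', e3', e4', e5'⟩
  obtain ⟨TC, RC, QRC, QCC, QSC, hC⟩ := swapC (P := P) (FR := {p, p'}) (FS := ∅) hF latE hDB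
    (FC := [c, c', c1, c2, c5].toFinset ∪ QCA ∪ QCE) (by simp) hr14 n12 ⟨E7, Pw⟩ ⟨E8, Pr4⟩
    Me Be (by rw [Finset.mem_union, Finset.mem_union, not_or, not_or]; exact ⟨⟨eC, eA⟩, eE⟩)
    Me' Be' (by rw [Finset.mem_union, Finset.mem_union, not_or, not_or]; exact ⟨⟨eC', eA'⟩, eE'⟩)
    (fun x y z h1 h2 h3 => by
      rw [Finset.mem_union, Finset.mem_union, not_or, not_or] at h3
      rw [offE2 _ _ _ h3.2, offA2 _ _ _ h3.1.2]
      exact hgood x y z h1 h2) (by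
      have h1 := c1u _ _ _ _ (c1u _ _ _ _ (card8 [c, c', c1, c2, c5]) hA.cS) hE.cS
      have h2 : ({p, p'} : Finset α).card ≤ 2 := Finset.card_le_two
      simp only [List.length_cons, List.length_nil] at h1
      rw [Finset.card_empty]
      omega)
  have latC : Lat TC := hC.lat.s12
  have sC : ∀ {a b z}, b ∈ [c, c', c1, c2, c5].toFinset → b ≠ c' → TE a b z → TC a b z :=
    fun {a b z} h1 h2 h3 => (hC.offR b a z (hC.avR b
      (Finset.mem_union_left _ (Finset.mem_union_left _ h1)) h2)).mpr h3
  have C00 : TC r1 c' x := hC.n1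
  have C0 : TC r1 c2 s := sC (by simp) n7 E0
  have C1 : TC r1 c1 t := sC (by simp) n5 E1
  have C2 : TC r c t := sC (by simp) hcc'.symm E2
  have C3 : TC r c' s := hC.stay r s E3 (Ne.symm n1) hr4
  have C4 : TC r c1 x := sC (by simp) n5 E4
  have C5 : TC r' c s := sC (by simp) hcc'.symm E5
  have C6 : TC r1 c y := sC (by simp) hcc'.symm E6
  have C11 : TC r' c2 w' := sC (by simp) n7 E11
  have C12 : TC r' c5 y := sC (by simp) n3 E12
  have pC : p ∉ QRC := hC.avC p (by simp) (by assumption) (by assumption)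
  have pC' : p' ∉ QRC := hC.avC p' (by simp) (by assumption) (by assumption)
  have offC1 : ∀ a b z, a ∉ QRC → (TC a b z ↔ TE a b z) := fun a b z h => hC.offC b a z h
  -- swap F
  have pF : p ∉ [r, r1, r'].toFinset := by
    simp only [List.mem_toFinset, List.mem_cons, List.not_mem_nil, or_false, not_or]
    exact ⟨p1, p2, p3⟩
  have pF' : p' ∉ [r, r1, r'].toFinset := by
    simp only [List.mem_toFinset, List.mem_cons, List.not_mem_nil, or_false, not_or]
    exact ⟨p1', p2', p3'⟩
  obtain ⟨TF, RF, QRF, QCF, QSF, hFF⟩ := swap (P := P) (FC := ∅) (FS := ∅) hF latC hDB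
    (FR := [r, r1, r'].toFinset ∪ QRA ∪ QRE ∪ QRC) (by simp) (Ne.symm n13) hw'y ⟨C11, Pw'⟩
    ⟨C12, Pc5⟩
    Mp Bp (by
      rw [Finset.mem_union, Finset.mem_union, Finset.mem_union, not_or, not_or, not_or]
      exact ⟨⟨⟨pF, pA⟩, pE⟩, pC⟩)
    Mp' Bp' (by
      rw [Finset.mem_union, Finset.mem_union, Finset.mem_union, not_or, not_or, not_or]
      exact ⟨⟨⟨pF', pA'⟩, pE'⟩, pC'⟩)
    (fun x y z h1 h2 h3 => by
      rw [Finset.mem_union, Finset.mem_union, Finset.mem_union, not_or, not_or, not_or] at h3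
      rw [offC1 _ _ _ h3.2, offE1 _ _ _ h3.1.2, offA1 _ _ _ h3.1.1.2]
      exact hgood x y z h1 h2) (by
      have h1 := c1u _ _ _ _ (c1u _ _ _ _ (c1u _ _ _ _ (card8 [r, r1, r']) hA.cC) hE.cC) hC.cC
      simp only [List.length_cons, List.length_nil] at h1
      rw [Finset.card_empty]
      omega)
  have sF : ∀ {a b z}, a ∈ [r, r1, r'].toFinset → a ≠ r' → TC a b z → TF a b z :=
    fun {a b z} h1 h2 h3 => (hFF.offR a b z (hFF.avR a (Finset.mem_union_left _
      (Finset.mem_union_left _ (Finset.mem_union_left _ h1))) h2)).mpr h3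
  have F1 : TF r' c2 y := hFF.n1
  have F2 : TF r' c s := hFF.stay c s C5 (Ne.symm n6) hc5
  have F3 : TF r c t := sF (by simp) hrr'.symm C2
  have F4 : TF r c' s := sF (by simp) hrr'.symm C3
  have F5 : TF r c1 x := sF (by simp) hrr'.symm C4
  have F6 : TF r1 c y := sF (by simp) n2 C6
  have F7 : TF r1 c1 t := sF (by simp) n2 C1
  have F8 : TF r1 c' x := sF (by simp) n2 C00
  have F9 : TF r1 c2 s := sF (by simp) n2 C0
  -- core trade
  have hL := trade hFF.lat
    [(r,c,t),(r,c',s),(r,c1,x),(r',c,s),(r',c2,y),(r1,c,y),(r1,c1,t),(r1,c',x),(r1,c2,s)]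
    [(r,c,s),(r,c',x),(r,c1,t),(r',c,y),(r',c2,s),(r1,c,t),(r1,c1,x),(r1,c',s),(r1,c2,y)]
    (core_nodup hrr' n1 n2 hcc' n4 n5 n6 n7 n8)
    (by
      simp only [List.forall_mem_cons, F1, F2, F3, F4, F5, F6, F7, F8, F9]
      simp)
    (perm_of _ _ (r, r) [0, 1, 2, 3, 4, 5, 6, 7, 8] 9 rfl (by decide) rfl)
    (perm_of _ _ (r, r) [1, 2, 0, 4, 3, 6, 7, 8, 5] 9 rfl (by decide) rfl)
    (perm_of _ _ (r, r) [3, 7, 6, 5, 8, 0, 2, 1, 4] 9 rfl (by decide) rfl)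
  refine ⟨_, hL, Or.inr (by simp), ?_, RA.map (fun q => (q.2.1, q.2.2, q.1)) ++
    RE.map (fun q => (q.2.1, q.2.2, q.1)) ++ RC.map (fun q => (q.2.1, q.1, q.2.2)) ++ RF ++
    [(r,c,t),(r,c',s),(r,c1,x),(r',c,s),(r',c2,y),(r1,c,y),(r1,c1,t),(r1,c',x),(r1,c2,s)], ?_, ?_⟩
  · intro a b z hP h0
    have h1 : TA a b z := by
      by_contra h; exact (hA.rem z a b h0 h).2 hP
    have h2 : TE a b z := by
      by_contra h; exact (hE.rem z a b h1 h).2 hP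
    have h3 : TC a b z := by
      by_contra h; exact (hC.rem b a z h2 h).2 hP
    have h4 : TF a b z := by
      by_contra h; exact (hFF.rem a b z h3 h).2 hP
    refine Or.inl ⟨h4, ?_⟩
    simp only [List.mem_cons, List.not_mem_nil, or_false, not_or, Prod.mk.injEq]
    refine ⟨?_, ?_, ?_, ?_, ?_, ?_, ?_, ?_, ?_⟩ <;> rintro ⟨rfl, rfl, rfl⟩
    · exact hts (hP3 _ _ _ _ hP hPs)
    · exact hcc' (hP2 _ _ _ _ hP hPs)
    · exact Px hP
    · exact hrr' (hP1 _ _ _ _ hP hPs)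
    · exact n13 (hT.u2 Tc5 h0)
    · exact Py hP
    · exact n10 (hT.u2 Tc3 h0)
    · exact n12 (hT.u3 Tw h0)
    · exact n11 (hT.u2 Tc6 h0)
  · have h1 := hA.len
    have h2 := hE.len
    have h3 := hC.len
    have h4 := hFF.len
    simp only [List.length_append, List.length_map, List.length_cons, List.length_nil]
    omega
  · intro a b z h0 hn
    simp only [List.mem_append]
    by_cases h1 : TA a b z
    swap
    · exact Or.inl (Or.inl (Or.inl (Or.inl (List.mem_map.mpr ⟨_, (hA.rem z a b h0 h1).1, rfl⟩))))
    by_cases h2 : TE a b z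
    swap
    · exact Or.inl (Or.inl (Or.inl (Or.inr (List.mem_map.mpr ⟨_, (hE.rem z a b h1 h2).1, rfl⟩))))
    by_cases h3 : TC a b z
    swap
    · exact Or.inl (Or.inl (Or.inr (List.mem_map.mpr ⟨_, (hC.rem b a z h2 h3).1, rfl⟩)))
    by_cases h4 : TF a b z
    swap
    · exact Or.inl (Or.inr (hFF.rem a b z h3 h4).1)
    refine Or.inr ?_
    by_contra h
    exact hn (Or.inl ⟨h4, h⟩)

end LSQ

namespace LSQ
open scoped Classical

variable {α : Type} [Fintype α]

noncomputable def S3 (φ : α → α → α → ℕ) : ℕ := ∑ a, ∑ b, ∑ c, φ a b c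
noncomputable def ind (p : Prop) : ℕ := if p then 1 else 0
noncomputable def tot (B : α → α → α → Prop) : ℕ :=
  (Finset.univ.filter fun p : α × α × α => B p.1 p.2.1 p.2.2).card

theorem thin1 (φ : α → α → α → ℕ) (m : ℕ) (h : ∀ b c, ∑ a, φ a b c ≤ m) :
    S3 φ ≤ m * Fintype.card α ^ 2 := by
  unfold S3
  rw [Finset.sum_comm]
  calc ∑ b, ∑ a, ∑ c, φ a b c = ∑ b : α, ∑ c : α, ∑ a, φ a b c :=
        Finset.sum_congr rfl (fun b _ => Finset.sum_comm)
    _ ≤ ∑ b : α, ∑ c : α, m := Finset.sum_le_sum fun b _ => Finset.sum_le_sum fun c _ => h b c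
    _ = _ := by simp [Finset.card_univ]; ring

theorem thin2 (φ : α → α → α → ℕ) (m : ℕ) (h : ∀ a c, ∑ b, φ a b c ≤ m) :
    S3 φ ≤ m * Fintype.card α ^ 2 := by
  unfold S3
  calc ∑ a, ∑ b, ∑ c, φ a b c = ∑ a : α, ∑ c : α, ∑ b, φ a b c :=
        Finset.sum_congr rfl (fun b _ => Finset.sum_comm)
    _ ≤ ∑ b : α, ∑ c : α, m := Finset.sum_le_sum fun b _ => Finset.sum_le_sum fun c _ => h b c
    _ = _ := by simp [Finset.card_univ]; ring

theorem thin3 (φ : α → α → α → ℕ) (m : ℕ) (h : ∀ a b, ∑ c, φ a b c ≤ m) :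
    S3 φ ≤ m * Fintype.card α ^ 2 := by
  unfold S3
  calc ∑ a, ∑ b, ∑ c, φ a b c ≤ ∑ b : α, ∑ c : α, m :=
        Finset.sum_le_sum fun b _ => Finset.sum_le_sum fun c _ => h b c
    _ = _ := by simp [Finset.card_univ]; ring

theorem sum_ind_eq {β : Type} [Fintype β] (E : β → Prop) :
    ∑ a, ind (E a) = (Finset.univ.filter E).card := by
  unfold ind
  rw [Finset.card_filter]

theorem sum_ind_one (E : α → Prop) (h : ∀ a a', E a → E a' → a = a') : ∑ a, ind (E a) ≤ 1 := by
  rw [sum_ind_eq, Finset.card_le_one]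
  intro a ha b hb
  simp only [Finset.mem_filter, Finset.mem_univ, true_and] at ha hb
  exact h a b ha hb

theorem ev1 (E : α → α → α → Prop) (h : ∀ b c a a', E a b c → E a' b c → a = a') :
    S3 (fun a b c => ind (E a b c)) ≤ Fintype.card α ^ 2 := by
  have := thin1 (fun a b c => ind (E a b c)) 1 (fun b c => sum_ind_one (fun a => E a b c) (h b c))
  simpa using this
theorem ev2 (E : α → α → α → Prop) (h : ∀ a c b b', E a b c → E a b' c → b = b') :
    S3 (fun a b c => ind (E a b c)) ≤ Fintype.card α ^ 2 := by
  have := thin2 (fun a b c => ind (E a b c)) 1 (fun a c => sum_ind_one (fun b => E a b c) (h a c))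
  simpa using this
theorem ev3 (E : α → α → α → Prop) (h : ∀ a b c c', E a b c → E a b c' → c = c') :
    S3 (fun a b c => ind (E a b c)) ≤ Fintype.card α ^ 2 := by
  have := thin3 (fun a b c => ind (E a b c)) 1 (fun a b => sum_ind_one (fun c => E a b c) (h a b))
  simpa using this

theorem sum_inj (g : α → ℕ) (q : α → α) (hq : ∀ a b, q a = q b → a = b) :
    ∑ a, g (q a) ≤ ∑ a, g a := by
  rw [← Finset.sum_image (s := Finset.univ) (g := q) (f := g) (fun a _ b _ h => hq a b h)]
  exact Finset.sum_le_sum_of_subset (Finset.subset_univ _)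

theorem line_ind (Q : α → α → Prop) (f g : α → α) (h : ∀ a a', f a = f a' → g a = g a' → a = a')
    (m : ℕ) (hm : (Finset.univ.filter fun p : α × α => Q p.1 p.2).card ≤ m) :
    ∑ a, ind (Q (f a) (g a)) ≤ m := by
  rw [sum_ind_eq]
  refine le_trans ?_ hm
  apply Finset.card_le_card_of_injOn (fun a => (f a, g a))
  · intro a ha; simpa using ha
  · intro a _ b _ hab
    simp only [Prod.mk.injEq] at hab
    exact h a b hab.1 hab.2

theorem pair_ind (B : α → α → α → Prop) (f g k : α → α → α)
    (h : ∀ a b a' b', f a b = f a' b' → g a b = g a' b' → k a b = k a' b' → a = a' ∧ b = b') :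
    ∑ a, ∑ b, ind (B (f a b) (g a b) (k a b)) ≤ tot B := by
  rw [← Fintype.sum_prod_type' (fun a b => ind (B (f a b) (g a b) (k a b)))]
  rw [sum_ind_eq (fun x : α × α => B (f x.1 x.2) (g x.1 x.2) (k x.1 x.2))]
  apply Finset.card_le_card_of_injOn (fun a => (f a.1 a.2, g a.1 a.2, k a.1 a.2))
  · intro a ha; simpa using ha
  · rintro ⟨a, b⟩ _ ⟨a', b'⟩ _ hab
    simp only [Prod.mk.injEq] at hab
    have := h a b a' b' hab.1 hab.2.1 hab.2.2
    rw [this.1, this.2]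

theorem pair12 (B : α → α → α → Prop) (f g k : α → α → α)
    (h : ∀ a b a' b', f a b = f a' b' → g a b = g a' b' → k a b = k a' b' → a = a' ∧ b = b') :
    S3 (fun a b _ => ind (B (f a b) (g a b) (k a b))) ≤ tot B * Fintype.card α := by
  have h1 := pair_ind B f g k h
  unfold S3
  simp only [Finset.sum_const, Finset.card_univ, smul_eq_mul]
  simp only [← Finset.mul_sum]
  rw [mul_comm]
  exact Nat.mul_le_mul_right _ h1

theorem pair13 (B : α → α → α → Prop) (f g k : α → α → α)
    (h : ∀ a b a' b', f a b = f a' b' → g a b = g a' b' → k a b = k a' b' → a = a' ∧ b = b') :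
    S3 (fun a _ b => ind (B (f a b) (g a b) (k a b))) ≤ tot B * Fintype.card α := by
  have h1 := pair_ind B f g k h
  unfold S3
  simp only [Finset.sum_const, Finset.card_univ, smul_eq_mul]
  simp only [← Finset.mul_sum]
  rw [mul_comm]
  exact Nat.mul_le_mul_right _ h1

theorem tot_eq (B : α → α → α → Prop) : tot B = ∑ a, ∑ b, ∑ c, ind (B a b c) := by
  unfold tot
  rw [← sum_ind_eq (fun p : α × α × α => B p.1 p.2.1 p.2.2), Fintype.sum_prod_type]
  exact Finset.sum_congr rfl fun a _ => by rw [Fintype.sum_prod_type]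

theorem sum_RL (B : α → α → α → Prop) : ∑ x, RL B x = tot B := by
  rw [tot_eq]
  refine Finset.sum_congr rfl fun x _ => ?_
  unfold RL
  rw [← sum_ind_eq (fun p : α × α => B x p.1 p.2), Fintype.sum_prod_type]

theorem sum_CL (B : α → α → α → Prop) : ∑ x, CL B x = tot B := by
  rw [tot_eq, Finset.sum_comm]
  refine Finset.sum_congr rfl fun x _ => ?_
  unfold CL
  rw [← sum_ind_eq (fun p : α × α => B p.1 x p.2), Fintype.sum_prod_type]

theorem sum_SL (B : α → α → α → Prop) : ∑ x, SL B x = tot B := by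
  rw [tot_eq]
  have : ∀ a : α, ∑ b, ∑ c, ind (B a b c) = ∑ c, ∑ b, ind (B a b c) :=
    fun a => Finset.sum_comm
  rw [Finset.sum_congr rfl fun a _ => this a, Finset.sum_comm]
  refine Finset.sum_congr rfl fun x _ => ?_
  unfold SL
  rw [← sum_ind_eq (fun p : α × α => B p.1 p.2 x), Fintype.sum_prod_type]

theorem S3_add (φ ψ : α → α → α → ℕ) : S3 (fun a b c => φ a b c + ψ a b c) = S3 φ + S3 ψ := by
  simp [S3, Finset.sum_add_distrib]

theorem S3_mul (m : ℕ) (φ : α → α → α → ℕ) : S3 (fun a b c => m * φ a b c) = m * S3 φ := by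
  simp [S3, Finset.mul_sum]

theorem S3_list (l : List (α → α → α → ℕ)) (m : ℕ) (h : ∀ φ ∈ l, S3 φ ≤ m) :
    S3 (fun a b c => (l.map fun φ => φ a b c).sum) ≤ l.length * m := by
  induction l with
  | nil => simp [S3]
  | cons φ l ih =>
    simp only [List.map_cons, List.sum_cons, List.length_cons]
    rw [S3_add φ]
    rw [List.forall_mem_cons] at h
    have := ih h.2
    have := h.1
    linarith

theorem S3_evs (l : List (α → α → α → Prop)) (m : ℕ)
    (h : ∀ E ∈ l, S3 (fun a b c => ind (E a b c)) ≤ m) :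
    S3 (fun a b c => (l.map fun E => ind (E a b c)).sum) ≤ l.length * m := by
  have := S3_list (l.map fun E => fun a b c => ind (E a b c)) m (by simpa using h)
  simpa [List.map_map, Function.comp_def] using this

theorem S3_lt (φ : α → α → α → ℕ) (N : ℕ) (h : S3 φ < N * Fintype.card α ^ 3) :
    ∃ a b c, φ a b c < N := by
  by_contra! hc
  have : ∑ a : α, ∑ b : α, ∑ c : α, N ≤ S3 φ :=
    Finset.sum_le_sum fun a _ => Finset.sum_le_sum fun b _ => Finset.sum_le_sum fun c _ => hc a b c
  simp only [Finset.sum_const, Finset.card_univ, smul_eq_mul] at this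
  nlinarith

theorem evs_zero (l : List (α → α → α → Prop)) (a b c : α)
    (h : (l.map fun E => ind (E a b c)).sum = 0) : ∀ E ∈ l, ¬ E a b c := by
  intro E hE hh
  have := List.sum_eq_zero_iff.mp h (ind (E a b c)) (List.mem_map.mpr ⟨E, hE, rfl⟩)
  simp [ind, hh] at this

theorem pick3 (l1 l2 l3 : List (α → α → α → Prop)) (lw : List (α → α → α → ℕ))
    (N m1 m2 m3 m4 : ℕ)
    (h1 : ∀ E ∈ l1, S3 (fun a b c => ind (E a b c)) ≤ m1)
    (h2 : ∀ E ∈ l2, S3 (fun a b c => ind (E a b c)) ≤ m2)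
    (h3 : ∀ E ∈ l3, S3 (fun a b c => ind (E a b c)) ≤ m3)
    (h4 : ∀ φ ∈ lw, S3 φ ≤ m4)
    (h : N * (l1.length * m1 + l2.length * m2 + l3.length * m3) + 2 * (lw.length * m4) <
      N * Fintype.card α ^ 3) :
    ∃ a b c, (∀ E ∈ l1, ¬ E a b c) ∧ (∀ E ∈ l2, ¬ E a b c) ∧ (∀ E ∈ l3, ¬ E a b c) ∧
      2 * (lw.map fun φ => φ a b c).sum < N := by
  obtain ⟨a, b, c, hh⟩ := S3_lt (fun a b c => N * (((l1.map fun E => ind (E a b c)).sum +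
    (l2.map fun E => ind (E a b c)).sum) + (l3.map fun E => ind (E a b c)).sum) +
    2 * (lw.map fun φ => φ a b c).sum) N (by
      rw [S3_add, S3_mul, S3_mul, S3_add, S3_add]
      refine lt_of_le_of_lt ?_ h
      gcongr
      · exact S3_evs l1 m1 h1
      · exact S3_evs l2 m2 h2
      · exact S3_evs l3 m3 h3
      · exact S3_list lw m4 h4)
  have hz : ((l1.map fun E => ind (E a b c)).sum +
    (l2.map fun E => ind (E a b c)).sum) + (l3.map fun E => ind (E a b c)).sum = 0 := by
    by_contra hne
    have := Nat.le_mul_of_pos_right N (Nat.pos_of_ne_zero hne)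
    omega
  refine ⟨a, b, c, evs_zero l1 a b c (by omega), evs_zero l2 a b c (by omega),
    evs_zero l3 a b c (by omega), by omega⟩

end LSQ

namespace LSQ
open scoped Classical

variable {α : Type} [Fintype α]

theorem ksix {b1 b2 b3 b4 b5 b6 l1 l2 l3 l4 l5 l6 d1 d2 d3 d4 d5 d6 e0 S N' n k : ℕ}
    (h1 : b1 ≤ l1 + e0 + d1) (h2 : b2 ≤ l2 + e0 + d2) (h3 : b3 ≤ l3 + e0 + d3)
    (h4 : b4 ≤ l4 + e0 + d4) (h5 : b5 ≤ l5 + e0 + d5) (h6 : b6 ≤ l6 + e0 + d6)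
    (g1 : d1 ≤ 2) (g2 : d2 ≤ 2) (g3 : d3 ≤ 2) (g4 : d4 ≤ 2) (g5 : d5 ≤ 2) (g6 : d6 ≤ 2)
    (hS : l1 + l2 + l3 + l4 + l5 + l6 ≤ S) (hS' : 2 * S < N') (hN : N' + 79 + 12 * e0 = n)
    (hk : n ≤ 2 * k + 1) : b1 + b2 + b3 + b4 + b5 + b6 + 27 < k := by
  omega
theorem ksub0 (x0 x1 x2 x3 x4 x5 x6 x7 x8 x9 x10 x11 x12 x13 x14 x15 x16 x17 x18 x19 x20 : ℕ) : x0 + x1 + x8 + x6 + x13 + x14 ≤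
    x0 + (x1 + (x2 + (x3 + (x4 + (x5 + (x6 + (x7 + (x8 + (x9 + (x10 + (x11 + (x12 + (x13 + (x14 + (x15 + (x16 + (x17 + (x18 + (x19 + (x20 + 0)))))))))))))))))))) := by
  omega
theorem ksub1 (x0 x1 x2 x3 x4 x5 x6 x7 x8 x9 x10 x11 x12 x13 x14 x15 x16 x17 x18 x19 x20 : ℕ) : x0 + x3 + x10 + x7 + x15 + x16 ≤
    x0 + (x1 + (x2 + (x3 + (x4 + (x5 + (x6 + (x7 + (x8 + (x9 + (x10 + (x11 + (x12 + (x13 + (x14 + (x15 + (x16 + (x17 + (x18 + (x19 + (x20 + 0)))))))))))))))))))) := by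
  omega
theorem ksub2 (x0 x1 x2 x3 x4 x5 x6 x7 x8 x9 x10 x11 x12 x13 x14 x15 x16 x17 x18 x19 x20 : ℕ) : x0 + x2 + x17 + x18 + x11 + x12 ≤
    x0 + (x1 + (x2 + (x3 + (x4 + (x5 + (x6 + (x7 + (x8 + (x9 + (x10 + (x11 + (x12 + (x13 + (x14 + (x15 + (x16 + (x17 + (x18 + (x19 + (x20 + 0)))))))))))))))))))) := by
  omega
theorem ksub3 (x0 x1 x2 x3 x4 x5 x6 x7 x8 x9 x10 x11 x12 x13 x14 x15 x16 x17 x18 x19 x20 : ℕ) : x7 + x9 + x19 + x20 + x4 + x5 ≤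
    x0 + (x1 + (x2 + (x3 + (x4 + (x5 + (x6 + (x7 + (x8 + (x9 + (x10 + (x11 + (x12 + (x13 + (x14 + (x15 + (x16 + (x17 + (x18 + (x19 + (x20 + 0)))))))))))))))))))) := by
  omega

set_option maxHeartbeats 4000000 in
theorem step {M D T B P Lo : α → α → α → Prop} {τ : α → Bool} {k e0 N' : ℕ} (hF : Frame M D τ k)
    (hT : Lat T) (hDB : ∀ x y z, D x y z → B x y z)
    (hgood : ∀ x y z, M x y z → ¬ B x y z → T x y z ∧ ¬ P x y z)
    (hP2 : ∀ x y y' z, P x y z → P x y' z → y = y')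
    (hP1 : ∀ x x' y z, P x y z → P x' y z → x = x')
    (hP3 : ∀ x y z z', P x y z → P x y z' → z = z')
    (hR : ∀ x, RL P x ≤ e0) (hC : ∀ x, CL P x ≤ e0) (hS : ∀ x, SL P x ≤ e0)
    (lR : ∀ x, RL B x ≤ RL Lo x + e0 + RL D x) (lC : ∀ x, CL B x ≤ CL Lo x + e0 + CL D x)
    (lS : ∀ x, SL B x ≤ SL Lo x + e0 + SL D x)
    (hk : Fintype.card α ≤ 2 * k + 1) (hN : N' + 79 + 12 * e0 = Fintype.card α)
    (hnum : N' * (68 * Fintype.card α ^ 2 + 10 * (e0 * Fintype.card α ^ 2) +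
      8 * (tot B * Fintype.card α)) + 2 * (21 * (tot Lo * Fintype.card α ^ 2)) <
      N' * Fintype.card α ^ 3)
    {r c s : α} (hPs : P r c s) (hnT : ¬ T r c s) :
    ∃ T', Lat T' ∧ T' r c s ∧ (∀ x y z, P x y z → T x y z → T' x y z) ∧
      ∃ R : List (α × α × α), R.length ≤ 57 ∧ ∀ x y z, T x y z → ¬ T' x y z → (x, y, z) ∈ R := by
  have hM := hF.lat
  obtain ⟨t, T1⟩ := hT.e3 r c
  obtain ⟨c', T2⟩ := hT.e2 r s
  obtain ⟨r', T3⟩ := hT.e1 c s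
  choose X hX using fun b => hT.e3 r b
  choose Y hY using fun a => hT.e3 a c
  choose C3 hC3 using fun a => hT.e2 a t
  choose R3 hR3 using fun b => hT.e1 b t
  choose W hW using fun a => hT.e3 a c'
  choose R4 hR4 using fun b => hT.e1 c' (X b)
  choose C6 hC6 using fun a => hT.e2 a s
  choose R6 hR6 using fun d => hT.e1 d s
  choose W' hW' using fun d => hT.e3 r' d
  choose C5 hC5 using fun a => hT.e2 r' (Y a)
  choose ZA hZA using fun a b => hM.e3 a b
  choose ZA' hZA' using fun a b => hM.e3 (R3 b) (C3 a)
  choose ZE hZE using fun a d => hM.e3 a d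
  choose ZE' hZE' using fun a d => hM.e3 (R6 d) (C6 a)
  choose EE hEE using fun a b => hM.e2 a (X b)
  choose EE' hEE' using fun a b => hM.e2 (R4 b) (W a)
  choose PP hPP using fun a d => hM.e1 d (Y a)
  choose PP' hPP' using fun a d => hM.e1 (C5 a) (W' d)
  have iX : ∀ {a b}, X a = X b → a = b := fun {a b} h => hT.u2 (hX a) (h ▸ hX b)
  have iY : ∀ {a b}, Y a = Y b → a = b := fun {a b} h => hT.u1 (hY a) (h ▸ hY b)
  have iC3 : ∀ {a b}, C3 a = C3 b → a = b := fun {a b} h => hT.u1 (hC3 a) (h ▸ hC3 b)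
  have iR3 : ∀ {a b}, R3 a = R3 b → a = b := fun {a b} h => hT.u2 (hR3 a) (h ▸ hR3 b)
  have iW : ∀ {a b}, W a = W b → a = b := fun {a b} h => hT.u1 (hW a) (h ▸ hW b)
  have iR4 : ∀ {a b}, R4 a = R4 b → a = b := fun {a b} h => iX (hT.u3 (hR4 a) (h ▸ hR4 b))
  have iC6 : ∀ {a b}, C6 a = C6 b → a = b := fun {a b} h => hT.u1 (hC6 a) (h ▸ hC6 b)
  have iR6 : ∀ {a b}, R6 a = R6 b → a = b := fun {a b} h => hT.u2 (hR6 a) (h ▸ hR6 b)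
  have iW' : ∀ {a b}, W' a = W' b → a = b := fun {a b} h => hT.u2 (hW' a) (h ▸ hW' b)
  have iC5 : ∀ {a b}, C5 a = C5 b → a = b := fun {a b} h => iY (hT.u3 (hC5 a) (h ▸ hC5 b))
  have iZA1 : ∀ {a b d}, ZA a d = ZA b d → a = b := fun {a b d} h => hM.u1 (hZA a d) (h ▸ hZA b d)
  have iZA2 : ∀ {d a b}, ZA d a = ZA d b → a = b := fun {d a b} h => hM.u2 (hZA d a) (h ▸ hZA d b)
  have iZA'1 : ∀ {a b d}, ZA' a d = ZA' b d → a = b := fun {a b d} h => iC3 (hM.u2 (hZA' a d) (h ▸ hZA' b d))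
  have iZA'2 : ∀ {d a b}, ZA' d a = ZA' d b → a = b := fun {d a b} h => iR3 (hM.u1 (hZA' d a) (h ▸ hZA' d b))
  have iZE1 : ∀ {a b d}, ZE a d = ZE b d → a = b := fun {a b d} h => hM.u1 (hZE a d) (h ▸ hZE b d)
  have iZE3 : ∀ {d a b}, ZE d a = ZE d b → a = b := fun {d a b} h => hM.u2 (hZE d a) (h ▸ hZE d b)
  have iZE'1 : ∀ {a b d}, ZE' a d = ZE' b d → a = b := fun {a b d} h => iC6 (hM.u2 (hZE' a d) (h ▸ hZE' b d))
  have iZE'3 : ∀ {d a b}, ZE' d a = ZE' d b → a = b := fun {d a b} h => iR6 (hM.u1 (hZE' d a) (h ▸ hZE' d b))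
  have iEE1 : ∀ {a b d}, EE a d = EE b d → a = b := fun {a b d} h => hM.u1 (hEE a d) (h ▸ hEE b d)
  have iEE2 : ∀ {d a b}, EE d a = EE d b → a = b := fun {d a b} h => iX (hM.u3 (hEE d a) (h ▸ hEE d b))
  have iEE'1 : ∀ {a b d}, EE' a d = EE' b d → a = b := fun {a b d} h => iW (hM.u3 (hEE' a d) (h ▸ hEE' b d))
  have iEE'2 : ∀ {d a b}, EE' d a = EE' d b → a = b := fun {d a b} h => iR4 (hM.u1 (hEE' d a) (h ▸ hEE' d b))
  have iPP1 : ∀ {a b d}, PP a d = PP b d → a = b := fun {a b d} h => iY (hM.u3 (hPP a d) (h ▸ hPP b d))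
  have iPP3 : ∀ {d a b}, PP d a = PP d b → a = b := fun {d a b} h => hM.u2 (hPP d a) (h ▸ hPP d b)
  have iPP'1 : ∀ {a b d}, PP' a d = PP' b d → a = b := fun {a b d} h => iC5 (hM.u2 (hPP' a d) (h ▸ hPP' b d))
  have iPP'3 : ∀ {d a b}, PP' d a = PP' d b → a = b := fun {d a b} h => iW' (hM.u3 (hPP' d a) (h ▸ hPP' d b))
  obtain ⟨a, b, d, h1, h2, h3, h4⟩ := pick3
    [fun a b d => a = r,
      fun a b d => a = r',
      fun a b d => (C5 a) = c',
      fun a b d => b = c,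
      fun a b d => b = c',
      fun a b d => d = c,
      fun a b d => d = c',
      fun a b d => b = d,
      fun a b d => (C3 a) = b,
      fun a b d => (C6 a) = d,
      fun a b d => (W a) = (X b),
      fun a b d => (C5 a) = d,
      fun a b d => (W a) = t,
      fun a b d => (W' d) = t,
      fun a b d => (ZA a b) = t,
      fun a b d => (ZA a b) = s,
      fun a b d => (ZA a b) = (X b),
      fun a b d => (ZA a b) = (Y a),
      fun a b d => (ZA a b) = (W a),
      fun a b d => (ZA a b) = (W' d),
      fun a b d => (ZA a b) = (ZE a d),
      fun a b d => (ZA a b) = (ZE' a d),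
      fun a b d => (ZA' a b) = t,
      fun a b d => (ZA' a b) = s,
      fun a b d => (ZA' a b) = (X b),
      fun a b d => (ZA' a b) = (Y a),
      fun a b d => (ZA' a b) = (W a),
      fun a b d => (ZA' a b) = (W' d),
      fun a b d => (ZA' a b) = (ZE a d),
      fun a b d => (ZA' a b) = (ZE' a d),
      fun a b d => (ZE a d) = t,
      fun a b d => (ZE a d) = s,
      fun a b d => (ZE a d) = (X b),
      fun a b d => (ZE a d) = (Y a),
      fun a b d => (ZE a d) = (W a),
      fun a b d => (ZE a d) = (W' d),
      fun a b d => (ZE' a d) = t,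
      fun a b d => (ZE' a d) = s,
      fun a b d => (ZE' a d) = (X b),
      fun a b d => (ZE' a d) = (Y a),
      fun a b d => (ZE' a d) = (W a),
      fun a b d => (ZE' a d) = (W' d),
      fun a b d => (EE a b) = c,
      fun a b d => (EE a b) = c',
      fun a b d => (EE a b) = b,
      fun a b d => (EE a b) = d,
      fun a b d => (EE a b) = (C5 a),
      fun a b d => (EE a b) = (C3 a),
      fun a b d => (EE a b) = (C6 a),
      fun a b d => (EE' a b) = c,
      fun a b d => (EE' a b) = c',
      fun a b d => (EE' a b) = b,
      fun a b d => (EE' a b) = d,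
      fun a b d => (EE' a b) = (C5 a),
      fun a b d => (EE' a b) = (C3 a),
      fun a b d => (EE' a b) = (C6 a),
      fun a b d => (PP a d) = r,
      fun a b d => (PP a d) = a,
      fun a b d => (PP a d) = r',
      fun a b d => (PP a d) = (R3 b),
      fun a b d => (PP a d) = (R4 b),
      fun a b d => (PP a d) = (R6 d),
      fun a b d => (PP' a d) = r,
      fun a b d => (PP' a d) = a,
      fun a b d => (PP' a d) = r',
      fun a b d => (PP' a d) = (R3 b),
      fun a b d => (PP' a d) = (R4 b),
      fun a b d => (PP' a d) = (R6 d)]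
    [fun a b d => P r b (X b),
      fun a b d => P a c (Y a),
      fun a b d => P a (C3 a) t,
      fun a b d => P (R3 b) b t,
      fun a b d => P a c' (W a),
      fun a b d => P (R4 b) c' (X b),
      fun a b d => P a (C6 a) s,
      fun a b d => P (R6 d) d s,
      fun a b d => P r' d (W' d),
      fun a b d => P r' (C5 a) (Y a)]
    [fun a b d => B a b (ZA a b),
      fun a b d => B (R3 b) (C3 a) (ZA' a b),
      fun a b d => B a d (ZE a d),
      fun a b d => B (R6 d) (C6 a) (ZE' a d),
      fun a b d => B a (EE a b) (X b),
      fun a b d => B (R4 b) (EE' a b) (W a),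
      fun a b d => B (PP a d) d (Y a),
      fun a b d => B (PP' a d) (C5 a) (W' d)]
    [fun a b d => RL Lo a,
      fun a b d => RL Lo (R3 b),
      fun a b d => RL Lo (R4 b),
      fun a b d => RL Lo (R6 d),
      fun a b d => RL Lo (PP a d),
      fun a b d => RL Lo (PP' a d),
      fun a b d => CL Lo b,
      fun a b d => CL Lo d,
      fun a b d => CL Lo (C3 a),
      fun a b d => CL Lo (C5 a),
      fun a b d => CL Lo (C6 a),
      fun a b d => CL Lo (EE a b),
      fun a b d => CL Lo (EE' a b),
      fun a b d => SL Lo (ZA a b),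
      fun a b d => SL Lo (ZA' a b),
      fun a b d => SL Lo (ZE a d),
      fun a b d => SL Lo (ZE' a d),
      fun a b d => SL Lo (W a),
      fun a b d => SL Lo (X b),
      fun a b d => SL Lo (W' d),
      fun a b d => SL Lo (Y a)]
    N' (Fintype.card α ^ 2) (e0 * Fintype.card α ^ 2) (tot B * Fintype.card α) (tot Lo * Fintype.card α ^ 2)
    (by
      simp only [List.forall_mem_cons]
      exact ⟨ev1 (fun a b d => a = r) (fun _ _ _ _ h h' => id (h.trans h'.symm)),
        ev1 (fun a b d => a = r') (fun _ _ _ _ h h' => id (h.trans h'.symm)),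
        ev1 (fun a b d => (C5 a) = c') (fun _ _ _ _ h h' => iC5 (h.trans h'.symm)),
        ev2 (fun a b d => b = c) (fun _ _ _ _ h h' => id (h.trans h'.symm)),
        ev2 (fun a b d => b = c') (fun _ _ _ _ h h' => id (h.trans h'.symm)),
        ev3 (fun a b d => d = c) (fun _ _ _ _ h h' => id (h.trans h'.symm)),
        ev3 (fun a b d => d = c') (fun _ _ _ _ h h' => id (h.trans h'.symm)),
        ev2 (fun a b d => b = d) (fun _ _ _ _ h h' => id (h.trans h'.symm)),
        ev1 (fun a b d => (C3 a) = b) (fun _ _ _ _ h h' => iC3 (h.trans h'.symm)),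
        ev1 (fun a b d => (C6 a) = d) (fun _ _ _ _ h h' => iC6 (h.trans h'.symm)),
        ev1 (fun a b d => (W a) = (X b)) (fun _ _ _ _ h h' => iW (h.trans h'.symm)),
        ev1 (fun a b d => (C5 a) = d) (fun _ _ _ _ h h' => iC5 (h.trans h'.symm)),
        ev1 (fun a b d => (W a) = t) (fun _ _ _ _ h h' => iW (h.trans h'.symm)),
        ev3 (fun a b d => (W' d) = t) (fun _ _ _ _ h h' => iW' (h.trans h'.symm)),
        ev1 (fun a b d => (ZA a b) = t) (fun _ _ _ _ h h' => iZA1 (h.trans h'.symm)),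
        ev1 (fun a b d => (ZA a b) = s) (fun _ _ _ _ h h' => iZA1 (h.trans h'.symm)),
        ev1 (fun a b d => (ZA a b) = (X b)) (fun _ _ _ _ h h' => iZA1 (h.trans h'.symm)),
        ev2 (fun a b d => (ZA a b) = (Y a)) (fun _ _ _ _ h h' => iZA2 (h.trans h'.symm)),
        ev2 (fun a b d => (ZA a b) = (W a)) (fun _ _ _ _ h h' => iZA2 (h.trans h'.symm)),
        ev1 (fun a b d => (ZA a b) = (W' d)) (fun _ _ _ _ h h' => iZA1 (h.trans h'.symm)),
        ev2 (fun a b d => (ZA a b) = (ZE a d)) (fun _ _ _ _ h h' => iZA2 (h.trans h'.symm)),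
        ev2 (fun a b d => (ZA a b) = (ZE' a d)) (fun _ _ _ _ h h' => iZA2 (h.trans h'.symm)),
        ev1 (fun a b d => (ZA' a b) = t) (fun _ _ _ _ h h' => iZA'1 (h.trans h'.symm)),
        ev1 (fun a b d => (ZA' a b) = s) (fun _ _ _ _ h h' => iZA'1 (h.trans h'.symm)),
        ev1 (fun a b d => (ZA' a b) = (X b)) (fun _ _ _ _ h h' => iZA'1 (h.trans h'.symm)),
        ev2 (fun a b d => (ZA' a b) = (Y a)) (fun _ _ _ _ h h' => iZA'2 (h.trans h'.symm)),
        ev2 (fun a b d => (ZA' a b) = (W a)) (fun _ _ _ _ h h' => iZA'2 (h.trans h'.symm)),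
        ev1 (fun a b d => (ZA' a b) = (W' d)) (fun _ _ _ _ h h' => iZA'1 (h.trans h'.symm)),
        ev2 (fun a b d => (ZA' a b) = (ZE a d)) (fun _ _ _ _ h h' => iZA'2 (h.trans h'.symm)),
        ev2 (fun a b d => (ZA' a b) = (ZE' a d)) (fun _ _ _ _ h h' => iZA'2 (h.trans h'.symm)),
        ev1 (fun a b d => (ZE a d) = t) (fun _ _ _ _ h h' => iZE1 (h.trans h'.symm)),
        ev1 (fun a b d => (ZE a d) = s) (fun _ _ _ _ h h' => iZE1 (h.trans h'.symm)),
        ev1 (fun a b d => (ZE a d) = (X b)) (fun _ _ _ _ h h' => iZE1 (h.trans h'.symm)),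
        ev3 (fun a b d => (ZE a d) = (Y a)) (fun _ _ _ _ h h' => iZE3 (h.trans h'.symm)),
        ev3 (fun a b d => (ZE a d) = (W a)) (fun _ _ _ _ h h' => iZE3 (h.trans h'.symm)),
        ev1 (fun a b d => (ZE a d) = (W' d)) (fun _ _ _ _ h h' => iZE1 (h.trans h'.symm)),
        ev1 (fun a b d => (ZE' a d) = t) (fun _ _ _ _ h h' => iZE'1 (h.trans h'.symm)),
        ev1 (fun a b d => (ZE' a d) = s) (fun _ _ _ _ h h' => iZE'1 (h.trans h'.symm)),
        ev1 (fun a b d => (ZE' a d) = (X b)) (fun _ _ _ _ h h' => iZE'1 (h.trans h'.symm)),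
        ev3 (fun a b d => (ZE' a d) = (Y a)) (fun _ _ _ _ h h' => iZE'3 (h.trans h'.symm)),
        ev3 (fun a b d => (ZE' a d) = (W a)) (fun _ _ _ _ h h' => iZE'3 (h.trans h'.symm)),
        ev1 (fun a b d => (ZE' a d) = (W' d)) (fun _ _ _ _ h h' => iZE'1 (h.trans h'.symm)),
        ev1 (fun a b d => (EE a b) = c) (fun _ _ _ _ h h' => iEE1 (h.trans h'.symm)),
        ev1 (fun a b d => (EE a b) = c') (fun _ _ _ _ h h' => iEE1 (h.trans h'.symm)),
        ev1 (fun a b d => (EE a b) = b) (fun _ _ _ _ h h' => iEE1 (h.trans h'.symm)),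
        ev1 (fun a b d => (EE a b) = d) (fun _ _ _ _ h h' => iEE1 (h.trans h'.symm)),
        ev2 (fun a b d => (EE a b) = (C5 a)) (fun _ _ _ _ h h' => iEE2 (h.trans h'.symm)),
        ev2 (fun a b d => (EE a b) = (C3 a)) (fun _ _ _ _ h h' => iEE2 (h.trans h'.symm)),
        ev2 (fun a b d => (EE a b) = (C6 a)) (fun _ _ _ _ h h' => iEE2 (h.trans h'.symm)),
        ev1 (fun a b d => (EE' a b) = c) (fun _ _ _ _ h h' => iEE'1 (h.trans h'.symm)),
        ev1 (fun a b d => (EE' a b) = c') (fun _ _ _ _ h h' => iEE'1 (h.trans h'.symm)),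
        ev1 (fun a b d => (EE' a b) = b) (fun _ _ _ _ h h' => iEE'1 (h.trans h'.symm)),
        ev1 (fun a b d => (EE' a b) = d) (fun _ _ _ _ h h' => iEE'1 (h.trans h'.symm)),
        ev2 (fun a b d => (EE' a b) = (C5 a)) (fun _ _ _ _ h h' => iEE'2 (h.trans h'.symm)),
        ev2 (fun a b d => (EE' a b) = (C3 a)) (fun _ _ _ _ h h' => iEE'2 (h.trans h'.symm)),
        ev2 (fun a b d => (EE' a b) = (C6 a)) (fun _ _ _ _ h h' => iEE'2 (h.trans h'.symm)),
        ev1 (fun a b d => (PP a d) = r) (fun _ _ _ _ h h' => iPP1 (h.trans h'.symm)),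
        ev3 (fun a b d => (PP a d) = a) (fun _ _ _ _ h h' => iPP3 (h.trans h'.symm)),
        ev1 (fun a b d => (PP a d) = r') (fun _ _ _ _ h h' => iPP1 (h.trans h'.symm)),
        ev1 (fun a b d => (PP a d) = (R3 b)) (fun _ _ _ _ h h' => iPP1 (h.trans h'.symm)),
        ev1 (fun a b d => (PP a d) = (R4 b)) (fun _ _ _ _ h h' => iPP1 (h.trans h'.symm)),
        ev1 (fun a b d => (PP a d) = (R6 d)) (fun _ _ _ _ h h' => iPP1 (h.trans h'.symm)),
        ev1 (fun a b d => (PP' a d) = r) (fun _ _ _ _ h h' => iPP'1 (h.trans h'.symm)),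
        ev3 (fun a b d => (PP' a d) = a) (fun _ _ _ _ h h' => iPP'3 (h.trans h'.symm)),
        ev1 (fun a b d => (PP' a d) = r') (fun _ _ _ _ h h' => iPP'1 (h.trans h'.symm)),
        ev1 (fun a b d => (PP' a d) = (R3 b)) (fun _ _ _ _ h h' => iPP'1 (h.trans h'.symm)),
        ev1 (fun a b d => (PP' a d) = (R4 b)) (fun _ _ _ _ h h' => iPP'1 (h.trans h'.symm)),
        ev1 (fun a b d => (PP' a d) = (R6 d)) (fun _ _ _ _ h h' => iPP'1 (h.trans h'.symm)),
        fun _ h => absurd h List.not_mem_nil⟩)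
    (by
      simp only [List.forall_mem_cons]
      exact ⟨thin2 (fun a b d => ind (P r b (X b))) e0 (fun _ _ => line_ind (fun u v => P r u v) (fun b => b) (fun b => (X b)) (fun _ _ h _ => id h) e0 (hR r)),
        thin1 (fun a b d => ind (P a c (Y a))) e0 (fun _ _ => line_ind (fun u v => P u c v) (fun a => a) (fun a => (Y a)) (fun _ _ h _ => id h) e0 (hC c)),
        thin1 (fun a b d => ind (P a (C3 a) t)) e0 (fun _ _ => line_ind (fun u v => P u v t) (fun a => a) (fun a => (C3 a)) (fun _ _ h _ => id h) e0 (hS t)),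
        thin2 (fun a b d => ind (P (R3 b) b t)) e0 (fun _ _ => line_ind (fun u v => P u v t) (fun b => (R3 b)) (fun b => b) (fun _ _ h _ => iR3 h) e0 (hS t)),
        thin1 (fun a b d => ind (P a c' (W a))) e0 (fun _ _ => line_ind (fun u v => P u c' v) (fun a => a) (fun a => (W a)) (fun _ _ h _ => id h) e0 (hC c')),
        thin2 (fun a b d => ind (P (R4 b) c' (X b))) e0 (fun _ _ => line_ind (fun u v => P u c' v) (fun b => (R4 b)) (fun b => (X b)) (fun _ _ h _ => iR4 h) e0 (hC c')),
        thin1 (fun a b d => ind (P a (C6 a) s)) e0 (fun _ _ => line_ind (fun u v => P u v s) (fun a => a) (fun a => (C6 a)) (fun _ _ h _ => id h) e0 (hS s)),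
        thin3 (fun a b d => ind (P (R6 d) d s)) e0 (fun _ _ => line_ind (fun u v => P u v s) (fun d => (R6 d)) (fun d => d) (fun _ _ h _ => iR6 h) e0 (hS s)),
        thin3 (fun a b d => ind (P r' d (W' d))) e0 (fun _ _ => line_ind (fun u v => P r' u v) (fun d => d) (fun d => (W' d)) (fun _ _ h _ => id h) e0 (hR r')),
        thin1 (fun a b d => ind (P r' (C5 a) (Y a))) e0 (fun _ _ => line_ind (fun u v => P r' u v) (fun a => (C5 a)) (fun a => (Y a)) (fun _ _ h _ => iC5 h) e0 (hR r')),
        fun _ h => absurd h List.not_mem_nil⟩)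
    (by
      simp only [List.forall_mem_cons]
      exact ⟨pair12 B (fun a b => a) (fun a b => b) (fun a b => (ZA a b)) (fun _ _ _ _ h1 h2 h3 => ⟨id h1, id h2⟩),
        pair12 B (fun a b => (R3 b)) (fun a b => (C3 a)) (fun a b => (ZA' a b)) (fun _ _ _ _ h1 h2 h3 => ⟨iC3 h2, iR3 h1⟩),
        pair13 B (fun a d => a) (fun a d => d) (fun a d => (ZE a d)) (fun _ _ _ _ h1 h2 h3 => ⟨id h1, id h2⟩),
        pair13 B (fun a d => (R6 d)) (fun a d => (C6 a)) (fun a d => (ZE' a d)) (fun _ _ _ _ h1 h2 h3 => ⟨iC6 h2, iR6 h1⟩),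
        pair12 B (fun a b => a) (fun a b => (EE a b)) (fun a b => (X b)) (fun _ _ _ _ h1 h2 h3 => ⟨id h1, iX h3⟩),
        pair12 B (fun a b => (R4 b)) (fun a b => (EE' a b)) (fun a b => (W a)) (fun _ _ _ _ h1 h2 h3 => ⟨iW h3, iR4 h1⟩),
        pair13 B (fun a d => (PP a d)) (fun a d => d) (fun a d => (Y a)) (fun _ _ _ _ h1 h2 h3 => ⟨iY h3, id h2⟩),
        pair13 B (fun a d => (PP' a d)) (fun a d => (C5 a)) (fun a d => (W' d)) (fun _ _ _ _ h1 h2 h3 => ⟨iC5 h2, iW' h3⟩),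
        fun _ h => absurd h List.not_mem_nil⟩)
    (by
      simp only [List.forall_mem_cons]
      exact ⟨thin1 (fun a b d => RL Lo a) (tot Lo) (fun _ _ => (sum_inj (RL Lo) (fun a => a) (fun _ _ h => id h)).trans (sum_RL Lo).le),
        thin2 (fun a b d => RL Lo (R3 b)) (tot Lo) (fun _ _ => (sum_inj (RL Lo) (fun b => (R3 b)) (fun _ _ h => iR3 h)).trans (sum_RL Lo).le),
        thin2 (fun a b d => RL Lo (R4 b)) (tot Lo) (fun _ _ => (sum_inj (RL Lo) (fun b => (R4 b)) (fun _ _ h => iR4 h)).trans (sum_RL Lo).le),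
        thin3 (fun a b d => RL Lo (R6 d)) (tot Lo) (fun _ _ => (sum_inj (RL Lo) (fun d => (R6 d)) (fun _ _ h => iR6 h)).trans (sum_RL Lo).le),
        thin1 (fun a b d => RL Lo (PP a d)) (tot Lo) (fun _ d => (sum_inj (RL Lo) (fun a => (PP a d)) (fun _ _ h => iPP1 h)).trans (sum_RL Lo).le),
        thin1 (fun a b d => RL Lo (PP' a d)) (tot Lo) (fun _ d => (sum_inj (RL Lo) (fun a => (PP' a d)) (fun _ _ h => iPP'1 h)).trans (sum_RL Lo).le),
        thin2 (fun a b d => CL Lo b) (tot Lo) (fun _ _ => (sum_inj (CL Lo) (fun b => b) (fun _ _ h => id h)).trans (sum_CL Lo).le),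
        thin3 (fun a b d => CL Lo d) (tot Lo) (fun _ _ => (sum_inj (CL Lo) (fun d => d) (fun _ _ h => id h)).trans (sum_CL Lo).le),
        thin1 (fun a b d => CL Lo (C3 a)) (tot Lo) (fun _ _ => (sum_inj (CL Lo) (fun a => (C3 a)) (fun _ _ h => iC3 h)).trans (sum_CL Lo).le),
        thin1 (fun a b d => CL Lo (C5 a)) (tot Lo) (fun _ _ => (sum_inj (CL Lo) (fun a => (C5 a)) (fun _ _ h => iC5 h)).trans (sum_CL Lo).le),
        thin1 (fun a b d => CL Lo (C6 a)) (tot Lo) (fun _ _ => (sum_inj (CL Lo) (fun a => (C6 a)) (fun _ _ h => iC6 h)).trans (sum_CL Lo).le),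
        thin1 (fun a b d => CL Lo (EE a b)) (tot Lo) (fun b _ => (sum_inj (CL Lo) (fun a => (EE a b)) (fun _ _ h => iEE1 h)).trans (sum_CL Lo).le),
        thin1 (fun a b d => CL Lo (EE' a b)) (tot Lo) (fun b _ => (sum_inj (CL Lo) (fun a => (EE' a b)) (fun _ _ h => iEE'1 h)).trans (sum_CL Lo).le),
        thin1 (fun a b d => SL Lo (ZA a b)) (tot Lo) (fun b _ => (sum_inj (SL Lo) (fun a => (ZA a b)) (fun _ _ h => iZA1 h)).trans (sum_SL Lo).le),
        thin1 (fun a b d => SL Lo (ZA' a b)) (tot Lo) (fun b _ => (sum_inj (SL Lo) (fun a => (ZA' a b)) (fun _ _ h => iZA'1 h)).trans (sum_SL Lo).le),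
        thin1 (fun a b d => SL Lo (ZE a d)) (tot Lo) (fun _ d => (sum_inj (SL Lo) (fun a => (ZE a d)) (fun _ _ h => iZE1 h)).trans (sum_SL Lo).le),
        thin1 (fun a b d => SL Lo (ZE' a d)) (tot Lo) (fun _ d => (sum_inj (SL Lo) (fun a => (ZE' a d)) (fun _ _ h => iZE'1 h)).trans (sum_SL Lo).le),
        thin1 (fun a b d => SL Lo (W a)) (tot Lo) (fun _ _ => (sum_inj (SL Lo) (fun a => (W a)) (fun _ _ h => iW h)).trans (sum_SL Lo).le),
        thin2 (fun a b d => SL Lo (X b)) (tot Lo) (fun _ _ => (sum_inj (SL Lo) (fun b => (X b)) (fun _ _ h => iX h)).trans (sum_SL Lo).le),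
        thin3 (fun a b d => SL Lo (W' d)) (tot Lo) (fun _ _ => (sum_inj (SL Lo) (fun d => (W' d)) (fun _ _ h => iW' h)).trans (sum_SL Lo).le),
        thin1 (fun a b d => SL Lo (Y a)) (tot Lo) (fun _ _ => (sum_inj (SL Lo) (fun a => (Y a)) (fun _ _ h => iY h)).trans (sum_SL Lo).le),
        fun _ h => absurd h List.not_mem_nil⟩)
    (by simpa only [List.length_cons, List.length_nil, Nat.reduceAdd, zero_add] using hnum)
  simp only [List.forall_mem_cons] at h1 h2 h3
  simp only [List.map_cons, List.map_nil, List.sum_cons, List.sum_nil] at h4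
  obtain ⟨q0, q1, q2, q3, q4, q5, q6, q7, q8, q9, q10, q11, q12, q13, q14, q15, q16, q17, q18, q19, q20, q21, q22, q23, q24, q25, q26, q27, q28, q29, q30, q31, q32, q33, q34, q35, q36, q37, q38, q39, q40, q41, q42, q43, q44, q45, q46, q47, q48, q49, q50, q51, q52, q53, q54, q55, q56, q57, q58, q59, q60, q61, q62, q63, q64, q65, q66, q67, -⟩ := h1
  obtain ⟨u0, u1, u2, u3, u4, u5, u6, u7, u8, u9, -⟩ := h2
  obtain ⟨v0, v1, v2, v3, v4, v5, v6, v7, -⟩ := h3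
  have d0 := hF.ld _ _ _ (hZA a b) (fun h => v0 (hDB _ _ _ h))
  have d1 := hF.ld _ _ _ (hZA' a b) (fun h => v1 (hDB _ _ _ h))
  have d2 := hF.ld _ _ _ (hZE a d) (fun h => v2 (hDB _ _ _ h))
  have d3 := hF.ld _ _ _ (hZE' a d) (fun h => v3 (hDB _ _ _ h))
  have d4 := hF.ld _ _ _ (hEE a b) (fun h => v4 (hDB _ _ _ h))
  have d5 := hF.ld _ _ _ (hEE' a b) (fun h => v5 (hDB _ _ _ h))
  have d6 := hF.ld _ _ _ (hPP a d) (fun h => v6 (hDB _ _ _ h))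
  have d7 := hF.ld _ _ _ (hPP' a d) (fun h => v7 (hDB _ _ _ h))
  refine step_core hF hT hDB hgood hP2 hP1 hP3 hPs hnT T1 T2 T3 (hX b) (hY a) (hC3 a) (hR3 b) (hW a) (hR4 b)
    (hC6 a) (hR6 d) (hW' d) (hC5 a) (hZA a b) (hZA' a b) (hZE a d) (hZE' a d) (hEE a b) (hEE' a b) (hPP a d) (hPP' a d)
    v0 v1 v2 v3 v4 v5 v6 v7
    u0 u1 u2 u3 u4 u5 u6 u7 u8 u9
    q0 q1 q2 q3 q4 q5 q6 q7 q8 q9 q10 q11 q12 q13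
    (by simp only [List.mem_toFinset, List.mem_cons, List.not_mem_nil, or_false, not_or]; exact ⟨q14, q15, q16, q17, q18, q19, q20, q21⟩)
    (by simp only [List.mem_toFinset, List.mem_cons, List.not_mem_nil, or_false, not_or]; exact ⟨q22, q23, q24, q25, q26, q27, q28, q29⟩)
    (by simp only [List.mem_toFinset, List.mem_cons, List.not_mem_nil, or_false, not_or]; exact ⟨q30, q31, q32, q33, q34, q35⟩)
    (by simp only [List.mem_toFinset, List.mem_cons, List.not_mem_nil, or_false, not_or]; exact ⟨q36, q37, q38, q39, q40, q41⟩)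
    (by simp only [List.mem_toFinset, List.mem_cons, List.not_mem_nil, or_false, not_or]; exact ⟨q42, q43, q44, q45, q46, q47, q48⟩)
    (by simp only [List.mem_toFinset, List.mem_cons, List.not_mem_nil, or_false, not_or]; exact ⟨q49, q50, q51, q52, q53, q54, q55⟩)
    (by simp only [List.mem_toFinset, List.mem_cons, List.not_mem_nil, or_false, not_or]; exact ⟨q56, q57, q58, q59, q60, q61⟩)
    (by simp only [List.mem_toFinset, List.mem_cons, List.not_mem_nil, or_false, not_or]; exact ⟨q62, q63, q64, q65, q66, q67⟩)
    (ksix (lR a) (lR (R3 b)) (lC (C3 a)) (lC b) (lS (ZA a b)) (lS (ZA' a b)) d0.1 d1.1 d1.2.1 d0.2.1 d0.2.2 d1.2.2 (ksub0 (RL Lo a) (RL Lo (R3 b)) (RL Lo (R4 b)) (RL Lo (R6 d)) (RL Lo (PP a d)) (RL Lo (PP' a d)) (CL Lo b) (CL Lo d) (CL Lo (C3 a)) (CL Lo (C5 a)) (CL Lo (C6 a)) (CL Lo (EE a b)) (CL Lo (EE' a b)) (SL Lo (ZA a b)) (SL Lo (ZA' a b)) (SL Lo (ZE a d)) (SL Lo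 (ZE' a d)) (SL Lo (W a)) (SL Lo (X b)) (SL Lo (W' d)) (SL Lo (Y a))) h4 hN hk)
    (ksix (lR a) (lR (R6 d)) (lC (C6 a)) (lC d) (lS (ZE a d)) (lS (ZE' a d)) d0.1 d3.1 d3.2.1 d2.2.1 d2.2.2 d3.2.2 (ksub1 (RL Lo a) (RL Lo (R3 b)) (RL Lo (R4 b)) (RL Lo (R6 d)) (RL Lo (PP a d)) (RL Lo (PP' a d)) (CL Lo b) (CL Lo d) (CL Lo (C3 a)) (CL Lo (C5 a)) (CL Lo (C6 a)) (CL Lo (EE a b)) (CL Lo (EE' a b)) (SL Lo (ZA a b)) (SL Lo (ZA' a b)) (SL Lo (ZE a d)) (SL Lo (ZE' a d)) (SL Lo (W a)) (SL Lo (X b)) (SL Lo (W' d)) (SL Lo (Y a))) h4 hN hk)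
    (ksix (lR a) (lR (R4 b)) (lS (W a)) (lS (X b)) (lC (EE a b)) (lC (EE' a b)) d0.1 d5.1 d5.2.2 d4.2.2 d4.2.1 d5.2.1 (ksub2 (RL Lo a) (RL Lo (R3 b)) (RL Lo (R4 b)) (RL Lo (R6 d)) (RL Lo (PP a d)) (RL Lo (PP' a d)) (CL Lo b) (CL Lo d) (CL Lo (C3 a)) (CL Lo (C5 a)) (CL Lo (C6 a)) (CL Lo (EE a b)) (CL Lo (EE' a b)) (SL Lo (ZA a b)) (SL Lo (ZA' a b)) (SL Lo (ZE a d)) (SL Lo (ZE' a d)) (SL Lo (W a)) (SL Lo (X b)) (SL Lo (W' d)) (SL Lo (Y a))) h4 hN hk)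
    (ksix (lC d) (lC (C5 a)) (lS (W' d)) (lS (Y a)) (lR (PP a d)) (lR (PP' a d)) d2.2.1 d7.2.1 d7.2.2 d6.2.2 d6.1 d7.1 (ksub3 (RL Lo a) (RL Lo (R3 b)) (RL Lo (R4 b)) (RL Lo (R6 d)) (RL Lo (PP a d)) (RL Lo (PP' a d)) (CL Lo b) (CL Lo d) (CL Lo (C3 a)) (CL Lo (C5 a)) (CL Lo (C6 a)) (CL Lo (EE a b)) (CL Lo (EE' a b)) (SL Lo (ZA a b)) (SL Lo (ZA' a b)) (SL Lo (ZE a d)) (SL Lo (ZE' a d)) (SL Lo (W a)) (SL Lo (X b)) (SL Lo (W' d)) (SL Lo (Y a))) h4 hN hk)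

end LSQ

namespace LSQ
open scoped Classical

theorem frame_even {G : Type} [Group G] [Fintype G] (τ : G → Bool) (k : ℕ)
    (hτ : ∀ x y, τ (x * y) = xor (τ x) (τ y)) (hinv : ∀ x, τ x = true → x * x = 1)
    (hbig : ∀ b, k ≤ cnt (fun x => τ x = b)) :
    Frame (fun x y z : G => x * y = z) (fun _ _ _ => False) τ k := by
  have h1 : τ 1 = false := by
    have := hτ 1 1
    rw [mul_one] at this
    revert this; cases τ 1 <;> simp
  have hi : ∀ x, τ x⁻¹ = τ x := by
    intro x
    have := hτ x x⁻¹
    rw [mul_inv_cancel, h1] at this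
    revert this; cases τ x <;> cases τ x⁻¹ <;> simp
  refine ⟨⟨fun y z => ⟨z * y⁻¹, by simp⟩, fun x z => ⟨x⁻¹ * z, by simp⟩, fun x y => ⟨_, rfl⟩, ?_, ?_, ?_⟩,
    ?_, ?_, hbig, ?_⟩
  · intro x x' y z h h'; exact mul_right_cancel (h.trans h'.symm)
  · intro x y y' z h h'; exact mul_left_cancel (h.trans h'.symm)
  · intro x y z z' h h'; exact h.symm.trans h'
  · rintro x y z rfl -
    rw [hτ]; cases τ x <;> cases τ y <;> rfl
  · rintro x1 x2 y1 y2 z1 z2 h h' rfl - - - ht -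
    subst h
    have h2 := hinv (x2 * x1⁻¹) (by
      rw [hτ, hi]; revert ht; cases τ x1 <;> cases τ x2 <;> simp)
    have h3 : y2 = x1⁻¹ * (x2 * y1) := by rw [← h']; simp
    rw [h3]
    calc x2 * (x1⁻¹ * (x2 * y1)) = (x2 * x1⁻¹ * (x2 * x1⁻¹)) * (x1 * y1) := by group
      _ = _ := by rw [h2, one_mul]
  · intro x y z _ _
    simp [RL, CL, SL]

/-- The prolongation of a group table along a near transversal. -/
def MO {G : Type} [Group G] (f g : G → G) (x0 : G) : Option G → Option G → Option G → Prop
  | some x, some y, some z => x * y = z ∧ ¬ (x ≠ x0 ∧ y = f x)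
  | some x, some y, none => x ≠ x0 ∧ y = f x
  | some x, none, some z => x ≠ x0 ∧ z = g x
  | none, some y, some z => ∃ x, x ≠ x0 ∧ y = f x ∧ z = g x
  | some x, none, none => x = x0
  | none, some y, none => y = f x0
  | none, none, some z => z = g x0
  | none, none, none => False

theorem lat_MO {G : Type} [Group G] (f g : G → G) (x0 : G) (hf : f.Bijective) (hg : g.Bijective)
    (hfg : ∀ x, x ≠ x0 → g x = x * f x) : Lat (MO f g x0) := by
  have fi := hf.injective
  have gi := hg.injective
  have rc : ∀ a b c : G, a * c = b * c → a = b := fun a b c h => mul_right_cancel h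
  have lc : ∀ a b c : G, a * b = a * c → b = c := fun a b c h => mul_left_cancel h
  refine ⟨?_, ?_, ?_, ?_, ?_, ?_⟩
  · rintro (_ | y) (_ | z)
    · exact ⟨some x0, rfl⟩
    · obtain ⟨x, rfl⟩ := hg.surjective z
      by_cases h : x = x0
      · exact ⟨none, by simp [MO, h]⟩
      · exact ⟨some x, by simp [MO, h]⟩
    · obtain ⟨x, rfl⟩ := hf.surjective y
      by_cases h : x = x0
      · exact ⟨none, by simp [MO, h]⟩
      · exact ⟨some x, by simp [MO, h]⟩
    · by_cases h : z * y⁻¹ ≠ x0 ∧ y = f (z * y⁻¹)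
      · refine ⟨none, z * y⁻¹, h.1, h.2, ?_⟩
        rw [hfg _ h.1, ← h.2]; simp
      · exact ⟨some (z * y⁻¹), by simp, h⟩
  · rintro (_ | x) (_ | z)
    · exact ⟨some (f x0), rfl⟩
    · obtain ⟨x, rfl⟩ := hg.surjective z
      by_cases h : x = x0
      · exact ⟨none, by simp [MO, h]⟩
      · exact ⟨some (f x), x, h, rfl, rfl⟩
    · by_cases h : x = x0
      · exact ⟨none, h⟩
      · exact ⟨some (f x), h, rfl⟩
    · by_cases h : x ≠ x0 ∧ x⁻¹ * z = f x
      · refine ⟨none, h.1, ?_⟩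
        rw [hfg _ h.1, ← h.2]; simp
      · exact ⟨some (x⁻¹ * z), by simp, h⟩
  · rintro (_ | x) (_ | y)
    · exact ⟨some (g x0), rfl⟩
    · obtain ⟨x, rfl⟩ := hf.surjective y
      by_cases h : x = x0
      · exact ⟨none, by simp [MO, h]⟩
      · exact ⟨some (g x), x, h, rfl, rfl⟩
    · by_cases h : x = x0
      · exact ⟨none, h⟩
      · exact ⟨some (g x), h, rfl⟩
    · by_cases h : x ≠ x0 ∧ y = f x
      · exact ⟨none, h⟩
      · exact ⟨some (x * y), rfl, h⟩
  · rintro (_ | x) (_ | x') (_ | y) (_ | z) h h' <;> simp only [MO] at h h' <;> grind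
  · rintro (_ | x) (_ | y) (_ | y') (_ | z) h h' <;> simp only [MO] at h h' <;> grind
  · rintro (_ | x) (_ | y) (_ | z) (_ | z') h h' <;> simp only [MO] at h h' <;> grind

section
variable {α : Type} [Fintype α]

theorem RL_D {α : Type} [Fintype α] {M : Option α → Option α → Option α → Prop} (hM : Lat M)
    (x : α) : RL (fun a b c => M a b c ∧ (a = none ∨ b = none ∨ c = none)) (some x) ≤ 2 := by
  obtain ⟨z0, hz⟩ := hM.e3 (some x) none
  obtain ⟨y0, hy⟩ := hM.e2 (some x) none
  refine le_trans (Finset.card_le_card (t := {(none, z0), (y0, none)}) ?_) Finset.card_le_two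
  rintro ⟨y, z⟩ h
  simp only [Finset.mem_filter, Finset.mem_univ, true_and, reduceCtorEq, false_or] at h
  simp only [Finset.mem_insert, Finset.mem_singleton, Prod.mk.injEq]
  rcases h with ⟨h, rfl | rfl⟩
  · exact Or.inl ⟨rfl, hM.u3 h hz⟩
  · exact Or.inr ⟨hM.u2 h hy, rfl⟩

theorem none_card {M : Option α → Option α → Option α → Prop} (hM : Lat M) :
    RL M none ≤ Fintype.card (Option α) := by
  rw [← Finset.card_univ]
  apply Finset.card_le_card_of_injOn Prod.fst
  · intro a _; simp
  · rintro ⟨a, b⟩ h ⟨a', b'⟩ h' rfl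
    simp only [Finset.coe_filter, Finset.mem_univ, true_and, Set.mem_ofPred_eq] at h h'
    rw [hM.u3 h h']

theorem tot_D {M : Option α → Option α → Option α → Prop} (hM : Lat M) :
    tot (fun a b c => M a b c ∧ (a = none ∨ b = none ∨ c = none)) ≤
      3 * Fintype.card (Option α) := by
  have h1 := none_card hM
  have h2 := none_card hM.s12
  have h3 := none_card hM.cyc
  have key : (Finset.univ.filter fun p : Option α × Option α × Option α =>
      M p.1 p.2.1 p.2.2 ∧ (p.1 = none ∨ p.2.1 = none ∨ p.2.2 = none)) ⊆
      ((Finset.univ.filter fun p : Option α × Option α => M none p.1 p.2).image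
        (fun p => (none, p.1, p.2))) ∪
      ((Finset.univ.filter fun p : Option α × Option α => M p.1 none p.2).image
        (fun p => (p.1, none, p.2))) ∪
      ((Finset.univ.filter fun p : Option α × Option α => M p.1 p.2 none).image
        (fun p => (p.1, p.2, none))) := by
    rintro ⟨x, y, z⟩ h
    simp only [Finset.mem_filter, Finset.mem_univ, true_and] at h
    simp only [Finset.mem_union, Finset.mem_image, Finset.mem_filter, Finset.mem_univ, true_and,
      Prod.exists, Prod.mk.injEq]
    rcases h with ⟨h, rfl | rfl | rfl⟩
    · exact Or.inl (Or.inl ⟨y, z, h, rfl, rfl, rfl⟩)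
    · exact Or.inl (Or.inr ⟨x, z, h, rfl, rfl, rfl⟩)
    · exact Or.inr ⟨x, y, h, rfl, rfl, rfl⟩
  have k1 := (Finset.card_le_card key).trans (Finset.card_union_le _ _)
  have k2 := k1.trans (Nat.add_le_add_right (Finset.card_union_le _ _) _)
  refine le_trans (le_of_eq (by unfold tot; congr)) (k2.trans ?_)
  have e1 : ((Finset.univ.filter fun p : Option α × Option α => M none p.1 p.2).image
        (fun p => ((none : Option α), p.1, p.2))).card ≤ _ := Finset.card_image_le.trans h1
  have e2 : ((Finset.univ.filter fun p : Option α × Option α => M p.1 none p.2).image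
        (fun p => (p.1, (none : Option α), p.2))).card ≤ _ := Finset.card_image_le.trans h2
  have e3 : ((Finset.univ.filter fun p : Option α × Option α => M p.1 p.2 none).image
        (fun p => (p.1, p.2, (none : Option α)))).card ≤ _ := Finset.card_image_le.trans h3
  omega

theorem frame_odd {G : Type} [Group G] [Fintype G] (τ : G → Bool) (k : ℕ)
    (hτ : ∀ x y, τ (x * y) = xor (τ x) (τ y)) (hinv : ∀ x, τ x = true → x * x = 1)
    (hbig : ∀ b, k ≤ cnt (fun x => τ x = b)) (f g : G → G) (x0 : G) (hf : f.Bijective)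
    (hg : g.Bijective) (hfg : ∀ x, x ≠ x0 → g x = x * f x) :
    Frame (MO f g x0) (fun a b c => MO f g x0 a b c ∧ (a = none ∨ b = none ∨ c = none))
      (fun a => a.elim false τ) k := by
  have hE := frame_even τ k hτ hinv hbig
  have hM := lat_MO f g x0 hf hg hfg
  refine ⟨hM, ?_, ?_, ?_, ?_⟩
  · intro a b c h hd
    simp only [h, true_and, not_or] at hd
    obtain ⟨x, rfl⟩ := Option.ne_none_iff_exists'.mp hd.1
    obtain ⟨y, rfl⟩ := Option.ne_none_iff_exists'.mp hd.2.1
    obtain ⟨z, rfl⟩ := Option.ne_none_iff_exists'.mp hd.2.2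
    exact hE.par x y z h.1 id
  · intro a1 a2 b1 b2 c1 c2 h1 h2 h3 d1 d2 d3 ht hv
    simp only [h1, h2, h3, true_and, not_or] at d1 d2 d3
    obtain ⟨x1, rfl⟩ := Option.ne_none_iff_exists'.mp d2.1
    obtain ⟨y1, rfl⟩ := Option.ne_none_iff_exists'.mp d1.2.1
    obtain ⟨z1, rfl⟩ := Option.ne_none_iff_exists'.mp d1.2.2
    obtain ⟨x2, rfl⟩ := Option.ne_none_iff_exists'.mp d1.1
    obtain ⟨y2, rfl⟩ := Option.ne_none_iff_exists'.mp d2.2.1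
    obtain ⟨z2, rfl⟩ := Option.ne_none_iff_exists'.mp d3.2.2
    have hz := hE.flip x1 x2 y1 y2 z1 z2 h1.1 h2.1 h3.1 id id id ht (Or.inl fun _ => id)
    refine ⟨hz, ?_⟩
    rintro ⟨hx, hy⟩
    have hz2 : z2 = g x2 := by rw [hfg x2 hx, ← hy]; exact hz.symm
    rcases hv with hv | hv | hv
    · exact hv none ⟨⟨hx, hy⟩, by simp⟩
    · exact hv none ⟨⟨hx, hz2⟩, by simp⟩
    · exact hv none ⟨⟨x2, hx, hy, hz2⟩, by simp⟩
  · intro b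
    refine (hbig b).trans ?_
    apply Finset.card_le_card_of_injOn some
    · intro a ha; simpa using ha
    · intro a _ a' _ h; exact Option.some_injective _ h
  · intro a b c h hd
    simp only [h, true_and, not_or] at hd
    obtain ⟨x, rfl⟩ := Option.ne_none_iff_exists'.mp hd.1
    obtain ⟨y, rfl⟩ := Option.ne_none_iff_exists'.mp hd.2.1
    obtain ⟨z, rfl⟩ := Option.ne_none_iff_exists'.mp hd.2.2
    refine ⟨RL_D hM x, ?_, ?_⟩
    · refine le_trans (le_of_eq ?_) (RL_D hM.s12 y)
      unfold RL CL s12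
      congr 1; ext p; simp only [Finset.mem_filter]; tauto
    · refine le_trans (le_of_eq ?_) (RL_D hM.cyc z)
      unfold RL SL cyc
      congr 1; ext p; simp only [Finset.mem_filter]; tauto

theorem fix_bij {G : Type} [Fintype G] (f : G → G) (x0 : G)
    (h : ∀ x y, x ≠ x0 → y ≠ x0 → f x = f y → x = y) :
    ∃ f' : G → G, f'.Bijective ∧ ∀ x, x ≠ x0 → f' x = f x := by
  have : ∃ y0, y0 ∉ (Finset.univ.erase x0).image f := by
    by_contra! hc
    have h1 : (Finset.univ : Finset G) ⊆ (Finset.univ.erase x0).image f := fun y _ => hc y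
    have h2 := (Finset.card_le_card h1).trans Finset.card_image_le
    rw [Finset.card_erase_of_mem (Finset.mem_univ _)] at h2
    have : 0 < (Finset.univ : Finset G).card := Finset.card_pos.mpr ⟨x0, Finset.mem_univ _⟩
    omega
  obtain ⟨y0, hy0⟩ := this
  have hy : ∀ x, x ≠ x0 → f x ≠ y0 := fun x hx he =>
    hy0 (Finset.mem_image.mpr ⟨x, by simpa using hx, he⟩)
  refine ⟨Function.update f x0 y0, ?_, fun x hx => by simp [hx]⟩
  rw [← Finite.injective_iff_bijective]
  intro x y hxy
  by_cases hx : x = x0 <;> by_cases hy' : y = x0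
  · rw [hx, hy']
  · subst hx
    rw [Function.update_self, Function.update_of_ne hy'] at hxy
    exact (hy y hy' hxy.symm).elim
  · subst hy'
    rw [Function.update_self, Function.update_of_ne hx] at hxy
    exact (hy x hx hxy).elim
  · rw [Function.update_of_ne hx, Function.update_of_ne hy'] at hxy
    exact h x y hx hy' hxy

end

end LSQ

namespace LSQ
open scoped Classical

/-- column function of a near transversal of the dihedral group -/
def ff (k : ℕ) : DihedralGroup k → DihedralGroup k
  | .r a => if a.val < (k + 1) / 2 then .r (a.val : ℕ) else .sr ((k - 1 - a.val : ℕ) : ZMod k)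
  | .sr a => if a.val < k / 2 then .sr ((2 * (k / 2) - 1 - a.val : ℕ) : ZMod k)
      else .r (((k + 1) / 2 + a.val - k / 2 : ℕ) : ZMod k)

/-- symbol function of a near transversal of the dihedral group -/
def gg (k : ℕ) : DihedralGroup k → DihedralGroup k
  | .r a => if a.val < (k + 1) / 2 then .r ((2 * a.val : ℕ) : ZMod k)
      else .sr ((2 * k - 1 - 2 * a.val : ℕ) : ZMod k)
  | .sr a => if a.val < k / 2 then .r ((2 * (k / 2) - 1 - 2 * a.val : ℕ) : ZMod k)
      else .sr (((k + 1) / 2 + 2 * a.val - k / 2 - k : ℕ) : ZMod k)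

/-- the reflection indicator -/
def tt (k : ℕ) : DihedralGroup k → Bool
  | .r _ => false
  | .sr _ => true

theorem castE {k m m' : ℕ} (hm : m < k) (hm' : m' < k) (h : (m : ZMod k) = (m' : ZMod k)) :
    m = m' := by
  have := congrArg ZMod.val h
  rwa [ZMod.val_natCast_of_lt hm, ZMod.val_natCast_of_lt hm'] at this

theorem castA {k m m' : ℕ} (h : m = m' + k) : (m : ZMod k) = (m' : ZMod k) := by
  rw [h]; simp

theorem ff_inj (k : ℕ) [NeZero k] (x y : DihedralGroup k) (hx : x ≠ .sr ((k - 1 : ℕ) : ZMod k))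
    (hy : y ≠ .sr ((k - 1 : ℕ) : ZMod k)) (h : ff k x = ff k y) : x = y := by
  have hz : ∀ a : ZMod k, (.sr a : DihedralGroup k) ≠ .sr ((k - 1 : ℕ) : ZMod k) → a.val ≠ k - 1 := by
    intro a ha he
    apply ha
    rw [← he]; simp
  rcases x with a | a <;> rcases y with b | b <;> have ha := ZMod.val_lt a <;>
    have hb := ZMod.val_lt b
  · simp only [ff] at h
    split_ifs at h <;> simp only [DihedralGroup.r.injEq, DihedralGroup.sr.injEq] at h
    · have := castE (by omega) (by omega) h
      rw [ZMod.val_injective k (show a.val = b.val by omega)]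
    · have := castE (by omega) (by omega) h
      rw [ZMod.val_injective k (show a.val = b.val by omega)]
  · have := hz b hy
    simp only [ff] at h
    split_ifs at h <;> simp only [DihedralGroup.r.injEq, DihedralGroup.sr.injEq] at h
    · have := castE (by omega) (by omega) h
      omega
    · have := castE (by omega) (by omega) h
      omega
  · have := hz a hx
    simp only [ff] at h
    split_ifs at h <;> simp only [DihedralGroup.r.injEq, DihedralGroup.sr.injEq] at h
    · have := castE (by omega) (by omega) h
      omega
    · have := castE (by omega) (by omega) h
      omega
  · have := hz a hx
    have := hz b hy
    simp only [ff] at h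
    split_ifs at h <;> simp only [DihedralGroup.r.injEq, DihedralGroup.sr.injEq] at h
    · have := castE (by omega) (by omega) h
      rw [ZMod.val_injective k (show a.val = b.val by omega)]
    · have := castE (by omega) (by omega) h
      rw [ZMod.val_injective k (show a.val = b.val by omega)]

theorem gg_inj (k : ℕ) [NeZero k] (x y : DihedralGroup k) (hx : x ≠ .sr ((k - 1 : ℕ) : ZMod k))
    (hy : y ≠ .sr ((k - 1 : ℕ) : ZMod k)) (h : gg k x = gg k y) : x = y := by
  have hz : ∀ a : ZMod k, (.sr a : DihedralGroup k) ≠ .sr ((k - 1 : ℕ) : ZMod k) → a.val ≠ k - 1 := by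
    intro a ha he
    apply ha
    rw [← he]; simp
  rcases x with a | a <;> rcases y with b | b <;> have ha := ZMod.val_lt a <;>
    have hb := ZMod.val_lt b
  · simp only [gg] at h
    split_ifs at h <;> simp only [DihedralGroup.r.injEq, DihedralGroup.sr.injEq] at h
    · have := castE (by omega) (by omega) h
      rw [ZMod.val_injective k (show a.val = b.val by omega)]
    · have := castE (by omega) (by omega) h
      rw [ZMod.val_injective k (show a.val = b.val by omega)]
  · have := hz b hy
    simp only [gg] at h
    split_ifs at h <;> simp only [DihedralGroup.r.injEq, DihedralGroup.sr.injEq] at h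
    · have := castE (by omega) (by omega) h
      rcases Nat.even_or_odd' k with ⟨j, hj | hj⟩ <;> omega
    · have := castE (by omega) (by omega) h
      rcases Nat.even_or_odd' k with ⟨j, hj | hj⟩ <;> omega
  · have := hz a hx
    simp only [gg] at h
    split_ifs at h <;> simp only [DihedralGroup.r.injEq, DihedralGroup.sr.injEq] at h
    · have := castE (by omega) (by omega) h
      rcases Nat.even_or_odd' k with ⟨j, hj | hj⟩ <;> omega
    · have := castE (by omega) (by omega) h
      rcases Nat.even_or_odd' k with ⟨j, hj | hj⟩ <;> omega
  · have := hz a hx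
    have := hz b hy
    simp only [gg] at h
    split_ifs at h <;> simp only [DihedralGroup.r.injEq, DihedralGroup.sr.injEq] at h
    · have := castE (by omega) (by omega) h
      rw [ZMod.val_injective k (show a.val = b.val by omega)]
    · have := castE (by omega) (by omega) h
      rw [ZMod.val_injective k (show a.val = b.val by omega)]

theorem gg_eq (k : ℕ) [NeZero k] (x : DihedralGroup k) : gg k x = x * ff k x := by
  have hh : ∀ a : ZMod k, ∃ m : ℕ, m < k ∧ a = (m : ZMod k) :=
    fun a => ⟨a.val, ZMod.val_lt a, (ZMod.natCast_zmod_val a).symm⟩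
  rcases x with a | a <;> obtain ⟨m, hm, rfl⟩ := hh a <;>
    simp only [gg, ff, ZMod.val_natCast_of_lt hm] <;> split_ifs with h
  · rw [DihedralGroup.r_mul_r, ← Nat.cast_add, two_mul]
  · rw [DihedralGroup.r_mul_sr]
    congr 1
    rw [eq_sub_iff_add_eq, ← Nat.cast_add]
    apply castA
    omega
  · rw [DihedralGroup.sr_mul_sr]
    congr 1
    rw [eq_sub_iff_add_eq, ← Nat.cast_add]
    congr 1
    omega
  · rw [DihedralGroup.sr_mul_r]
    congr 1
    rw [← Nat.cast_add]
    symm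
    apply castA
    omega

theorem tt_hom (k : ℕ) (x y : DihedralGroup k) : tt k (x * y) = xor (tt k x) (tt k y) := by
  rcases x with a | a <;> rcases y with b | b <;> rfl

theorem tt_inv (k : ℕ) (x : DihedralGroup k) (h : tt k x = true) : x * x = 1 := by
  rcases x with a | a
  · cases h
  · exact DihedralGroup.sr_mul_self a

theorem cnt_ge {α β : Type} [Fintype α] [Fintype β] (X : α → Prop) (f : β → α)
    (hf : Function.Injective f) (h : ∀ b, X (f b)) : Fintype.card β ≤ cnt X := by
  rw [← Finset.card_univ]
  apply Finset.card_le_card_of_injOn f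
  · intro a _; simpa using h a
  · intro a _ b _ e; exact hf e

theorem tt_big (k : ℕ) [NeZero k] (b : Bool) : k ≤ cnt (fun x => tt k x = b) := by
  have h : Fintype.card (ZMod k) = k := ZMod.card k
  cases b
  · exact h.symm.le.trans (cnt_ge _ DihedralGroup.r (fun a b h => by simpa using h) fun _ => rfl)
  · exact h.symm.le.trans (cnt_ge _ DihedralGroup.sr (fun a b h => by simpa using h) fun _ => rfl)

theorem exists_frame (n : ℕ) (hn : 2 ≤ n) : ∃ (α : Type) (_ : Fintype α) (M D : α → α → α → Prop)
    (τ : α → Bool) (k : ℕ), Fintype.card α = n ∧ n ≤ 2 * k + 1 ∧ Frame M D τ k ∧ tot D ≤ 3 * n := by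
  obtain ⟨k, hk⟩ := Nat.even_or_odd' n
  have : NeZero k := ⟨by omega⟩
  have hcard : Fintype.card (DihedralGroup k) = 2 * k := DihedralGroup.card
  rcases hk with rfl | rfl
  · have h1 := frame_even (tt k) k (tt_hom k) (tt_inv k) (tt_big k)
    have h2 : tot (fun _ _ _ : DihedralGroup k => False) ≤ 3 * (2 * k) := by simp [tot]
    exact ⟨DihedralGroup k, inferInstance, _, _, _, k, hcard, by omega, h1, h2⟩
  · obtain ⟨f, hf, hf'⟩ := fix_bij (ff k) _ (ff_inj k)
    obtain ⟨g, hg, hg'⟩ := fix_bij (gg k) _ (gg_inj k)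
    have hfg : ∀ x, x ≠ .sr ((k - 1 : ℕ) : ZMod k) → g x = x * f x :=
      fun x hx => by rw [hf' x hx, hg' x hx, gg_eq]
    have h1 := frame_odd (tt k) k (tt_hom k) (tt_inv k) (tt_big k) f g _ hf hg hfg
    have h2 := tot_D (lat_MO f g _ hf hg hfg)
    have h3 : Fintype.card (Option (DihedralGroup k)) = 2 * k + 1 := by
      rw [Fintype.card_option, hcard]
    rw [h3] at h2
    exact ⟨Option (DihedralGroup k), inferInstance, _, _, _, k, h3, by omega, h1, h2⟩

end LSQ

namespace LSQ
open scoped Classical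

theorem num_poly (N F : ℝ) (hN : 103 ≤ N) (hF : 10409 * F ≤ N ^ 2) :
    0 < N * (N - 79) * (N - 92) - 8 * (N - 79) * (58 * F - 57) - 2394 * (F - 1) * N := by
  have hA : 10409 * F * (464 * (N - 79) + 2394 * N) ≤ N ^ 2 * (464 * (N - 79) + 2394 * N) :=
    mul_le_mul_of_nonneg_right hF (by linarith)
  have hB : 0 < 7551 * N ^ 3 - 1743283 * N ^ 2 + 105318262 * N - 374973816 := by
    nlinarith [mul_nonneg (sq_nonneg (N - 113)) (sub_nonneg.mpr hN), sq_nonneg (N - 113)]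
  nlinarith

theorem num_real (n e F N' tB tL : ℝ) (he : 0 ≤ e) (hN' : 24 ≤ N') (hn : N' + 79 + 12 * e = n)
    (hF : 10409 * F ≤ (N' + 79) ^ 2) (hF1 : 1 ≤ F) (hL : tL ≤ 57 * (F - 1))
    (hB : tB ≤ F + 3 * n + tL) :
    N' * (68 * n ^ 2 + 10 * (e * n ^ 2) + 8 * (tB * n)) + 2 * (21 * (tL * n ^ 2)) < N' * n ^ 3 := by
  have hK := num_poly (N' + 79) F (by linarith) hF
  have hB' : tB ≤ 58 * F - 57 + 3 * n := by linarith
  have hn0 : 0 < n := by linarith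
  have h1 : N' * (8 * tB) ≤ N' * (8 * (58 * F - 57 + 3 * n)) :=
    mul_le_mul_of_nonneg_left (by linarith) (by linarith)
  have h2 : 42 * tL * n ≤ 2394 * (F - 1) * n := mul_le_mul_of_nonneg_right (by linarith) hn0.le
  -- the inequality after division by n
  have key : 0 < N' * n ^ 2 - N' * (68 * n + 10 * e * n + 8 * (58 * F - 57 + 3 * n))
      - 2394 * (F - 1) * n := by
    have hpos : 0 < N' + 79 := by linarith
    have h3 : 0 < n * ((N' + 79) * N' * (N' + 79 - 92) - 8 * N' * (58 * F - 57)
        - 2394 * (F - 1) * (N' + 79)) := by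
      apply mul_pos hn0
      have : N' + 79 - 79 = N' := by ring
      rwa [this] at hK
    have h4 : 0 ≤ 8 * N' * (58 * F - 57) * (n - (N' + 79)) :=
      mul_nonneg (mul_nonneg (by linarith) (by linarith)) (by linarith)
    have h5 : 0 ≤ 2 * e * N' * n * (N' + 79) := by positivity
    have h6 : 0 < (N' + 79) * (N' * n ^ 2 - N' * (68 * n + 10 * e * n + 8 * (58 * F - 57 + 3 * n))
      - 2394 * (F - 1) * n) := by
      have e1 : (N' + 79) * (N' * n ^ 2 - N' * (68 * n + 10 * e * n + 8 * (58 * F - 57 + 3 * n))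
        - 2394 * (F - 1) * n) = n * ((N' + 79) * N' * (N' + 79 - 92) - 8 * N' * (58 * F - 57)
        - 2394 * (F - 1) * (N' + 79)) + 8 * N' * (58 * F - 57) * (n - (N' + 79)) +
        2 * e * N' * n * (N' + 79) := by
        rw [← hn]; ring
      rw [e1]; linarith
    exact pos_of_mul_pos_right h6 hpos.le
  have h7 : N' * (68 * n + 10 * e * n + 8 * tB) + 42 * tL * n < N' * n ^ 2 := by nlinarith
  have h8 := mul_lt_mul_of_pos_right h7 hn0
  nlinarith

theorem num_nat (n e F N' tB tL : ℕ) (hn : N' + 79 + 12 * e = n) (hN' : 24 ≤ N')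
    (hF : 10409 * F < (N' + 79) ^ 2) (hL : tL + 57 ≤ 57 * F) (hF1 : 1 ≤ F)
    (hB : tB ≤ F + 3 * n + tL) :
    N' * (68 * n ^ 2 + 10 * (e * n ^ 2) + 8 * (tB * n)) + 2 * (21 * (tL * n ^ 2)) < N' * n ^ 3 := by
  have := num_real n e F N' tB tL (by positivity) (by exact_mod_cast hN') (by exact_mod_cast hn)
    (by exact_mod_cast hF.le) (by exact_mod_cast hF1)
    (by have : (tL : ℝ) + 57 ≤ 57 * F := by exact_mod_cast hL
        linarith) (by exact_mod_cast hB)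
  exact_mod_cast this

variable {α : Type} [Fintype α]

theorem tot_three {A X Y Z : α → α → α → Prop}
    (h : ∀ x y z, A x y z → X x y z ∨ Y x y z ∨ Z x y z) : tot A ≤ tot X + tot Y + tot Z := by
  unfold tot
  refine (Finset.card_le_card ?_).trans ((Finset.card_union_le _ _).trans
    (Nat.add_le_add_right (Finset.card_union_le _ _) _))
  intro p hp
  simp only [Finset.mem_filter, Finset.mem_univ, true_and, Finset.mem_union] at hp ⊢
  have := h _ _ _ hp
  tauto

theorem CL_three {A X Y Z : α → α → α → Prop}
    (h : ∀ x y z, A x y z → X x y z ∨ Y x y z ∨ Z x y z) (c : α) :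
    CL A c ≤ CL X c + CL Y c + CL Z c := by
  unfold CL
  refine (Finset.card_le_card ?_).trans ((Finset.card_union_le _ _).trans
    (Nat.add_le_add_right (Finset.card_union_le _ _) _))
  intro p hp
  simp only [Finset.mem_filter, Finset.mem_univ, true_and, Finset.mem_union] at hp ⊢
  have := h _ _ _ hp
  tauto

theorem RL_three {A X Y Z : α → α → α → Prop}
    (h : ∀ x y z, A x y z → X x y z ∨ Y x y z ∨ Z x y z) (c : α) :
    RL A c ≤ RL X c + RL Y c + RL Z c :=
  CL_three (A := s12 A) (X := s12 X) (Y := s12 Y) (Z := s12 Z) (fun x y z => h y x z) c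

theorem SL_three {A X Y Z : α → α → α → Prop}
    (h : ∀ x y z, A x y z → X x y z ∨ Y x y z ∨ Z x y z) (c : α) :
    SL A c ≤ SL X c + SL Y c + SL Z c :=
  CL_three (A := s23 A) (X := s23 X) (Y := s23 Y) (Z := s23 Z) (fun x y z => h x z y) c

theorem tot_list {A X : α → α → α → Prop} (R : List (α × α × α))
    (h : ∀ x y z, A x y z → X x y z ∨ (x, y, z) ∈ R) : tot A ≤ tot X + R.length := by
  unfold tot
  refine (Finset.card_le_card (t := (Finset.univ.filter fun p : α × α × α => X p.1 p.2.1 p.2.2) ∪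
    R.toFinset) ?_).trans ((Finset.card_union_le _ _).trans
    (Nat.add_le_add_left (List.toFinset_card_le _) _))
  rintro ⟨x, y, z⟩ hp
  simp only [Finset.mem_filter, Finset.mem_univ, true_and, Finset.mem_union, List.mem_toFinset] at hp ⊢
  exact h _ _ _ hp

theorem tot_lt {A X : α → α → α → Prop} (h : ∀ x y z, A x y z → X x y z) {r c s : α}
    (h1 : X r c s) (h2 : ¬ A r c s) : tot A < tot X := by
  unfold tot
  apply Finset.card_lt_card
  rw [Finset.ssubset_iff_of_subset]
  · exact ⟨(r, c, s), by simpa using h1, by simpa using h2⟩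
  · rintro ⟨x, y, z⟩ hp
    simp only [Finset.mem_filter, Finset.mem_univ, true_and] at hp ⊢
    exact h _ _ _ hp

theorem tot_false {A : α → α → α → Prop} (h : ∀ x y z, ¬ A x y z) : tot A = 0 := by
  unfold tot
  rw [Finset.card_eq_zero, Finset.filter_eq_empty_iff]
  rintro ⟨x, y, z⟩ _
  exact h x y z

theorem complete {M D P : α → α → α → Prop} {τ : α → Bool} {k e0 N : ℕ} (hF : Frame M D τ k)
    (hD : tot D ≤ 3 * Fintype.card α)
    (hP2 : ∀ x y y' z, P x y z → P x y' z → y = y')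
    (hP1 : ∀ x x' y z, P x y z → P x' y z → x = x')
    (hP3 : ∀ x y z z', P x y z → P x y z' → z = z')
    (hR : ∀ x, RL P x ≤ e0) (hC : ∀ x, CL P x ≤ e0) (hS : ∀ x, SL P x ≤ e0)
    (hk : Fintype.card α ≤ 2 * k + 1) (hN : N + 12 * e0 = Fintype.card α)
    (hnum : 10409 * tot P < N ^ 2) : ∃ T, Lat T ∧ ∀ x y z, P x y z → T x y z := by
  have main : ∀ j, (∃ T, Lat T ∧ ∀ x y z, P x y z → T x y z) ∨
      ∃ T, Lat T ∧ tot (fun x y z => M x y z ∧ ¬ T x y z) ≤ 57 * j ∧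
        j ≤ tot (fun x y z => P x y z ∧ T x y z) := by
    intro j
    induction j with
    | zero =>
      refine Or.inr ⟨M, hF.lat, ?_, Nat.zero_le _⟩
      rw [tot_false (fun x y z h => h.2 h.1)]
    | succ j ih =>
      rcases ih with h | ⟨T, hT, h1, h2⟩
      · exact Or.inl h
      by_cases hPT : ∀ x y z, P x y z → T x y z
      · exact Or.inl ⟨T, hT, hPT⟩
      push Not at hPT
      obtain ⟨r, c, s, hPs, hnT⟩ := hPT
      have h3 : tot (fun x y z => P x y z ∧ T x y z) < tot P :=
        tot_lt (fun x y z h => h.1) hPs (fun h => hnT h.2)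
      have hN103 : 103 ≤ N := by
        by_contra hlt
        have : N ≤ 102 := by omega
        have : N ^ 2 ≤ 102 ^ 2 := Nat.pow_le_pow_left this 2
        omega
      obtain ⟨N', rfl⟩ : ∃ N', N = N' + 79 := ⟨N - 79, by omega⟩
      have hB3 : ∀ x y z, ((M x y z ∧ ¬ T x y z) ∨ P x y z ∨ D x y z) →
        ((M x y z ∧ ¬ T x y z) ∨ P x y z ∨ D x y z) := fun _ _ _ h => h
      have htB := tot_three hB3
      obtain ⟨T', hT', hrcs, hkeep, R, hRl, hRm⟩ := step (T := T) (P := P)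
        (B := fun x y z => (M x y z ∧ ¬ T x y z) ∨ P x y z ∨ D x y z)
        (Lo := fun x y z => M x y z ∧ ¬ T x y z) hF hT (fun x y z h => Or.inr (Or.inr h))
        (fun x y z hm hb => ⟨by by_contra ht; exact hb (Or.inl ⟨hm, ht⟩),
          fun hp => hb (Or.inr (Or.inl hp))⟩) hP2 hP1 hP3 hR hC hS
        (fun x => (RL_three hB3 x).trans (by have := hR x; omega))
        (fun x => (CL_three hB3 x).trans (by have := hC x; omega))
        (fun x => (SL_three hB3 x).trans (by have := hS x; omega)) hk hN
        (num_nat _ e0 (tot P) N' _ _ hN (by omega) hnum (by omega) (by omega) (by omega))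
        hPs hnT
      refine Or.inr ⟨T', hT', ?_, ?_⟩
      · have := tot_list (A := fun x y z => M x y z ∧ ¬ T' x y z)
          (X := fun x y z => M x y z ∧ ¬ T x y z) R (fun x y z h => by
            by_cases ht : T x y z
            · exact Or.inr (hRm x y z ht h.2)
            · exact Or.inl ⟨h.1, ht⟩)
        omega
      · have := tot_lt (A := fun x y z => P x y z ∧ T x y z) (X := fun x y z => P x y z ∧ T' x y z)
          (fun x y z h => ⟨h.1, hkeep x y z h.1 h.2⟩) ⟨hPs, hrcs⟩ (fun h => hnT h.2)
        omega
  rcases main (tot P + 1) with h | ⟨T, hT, -, h2⟩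
  · exact h
  · have := tot_three (A := fun x y z => P x y z ∧ T x y z) (X := P) (Y := fun _ _ _ => False)
      (Z := fun _ _ _ => False) (fun x y z h => Or.inl h.1)
    rw [tot_false (fun x y z h => h)] at this
    omega

end LSQ


/-- Every `ε`-dense partial latin square of order `n` with at most `δ n²`
filled cells is completable, when `0 ≤ ε < 1/12` and
`0 ≤ δ < (1 - 12ε)² / 10409`. -/
theorem dense_sparse_partial_latin_square_completable
    (n : ℕ) (hn : 0 < n) (ε δ : ℝ) (hε0 : 0 ≤ ε) (hε : ε < 1 / 12)
    (hδ0 : 0 ≤ δ) (hδ : δ < (1 - 12 * ε) ^ 2 / 10409)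
    (P : Fin n → Fin n → Option (Fin n))
    (hP : IsPartialLatinSquare P) (hdense : IsEpsDense ε P)
    (hfill : (filledCells P : ℝ) ≤ δ * n ^ 2) :
    ∃ L : Fin n → Fin n → Fin n, IsLatinSquare L ∧ Completes L P := by
  rcases Nat.lt_or_ge n 2 with h2 | h2
  · have hs : Subsingleton (Fin n) := by
      have : n = 1 := by omega
      subst this; infer_instance
    refine ⟨fun i _ => i, ⟨fun i => ?_, fun j => ?_⟩, fun i j s _ => Subsingleton.elim _ _⟩
    · exact ⟨fun a b _ => Subsingleton.elim _ _, fun b => ⟨b, Subsingleton.elim _ _⟩⟩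
    · exact ⟨fun a b _ => Subsingleton.elim _ _, fun b => ⟨b, Subsingleton.elim _ _⟩⟩
  obtain ⟨α, _, M, D, τ, k, hcard, hk, hF, hD⟩ := LSQ.exists_frame n h2
  let e : Fin n ≃ α := (Fintype.equivFinOfCardEq hcard).symm
  let P' : α → α → α → Prop := fun x y z => P (e.symm x) (e.symm y) = some (e.symm z)
  obtain ⟨hr, hc, hsy⟩ := hdense
  have hn' : (0 : ℝ) < n := by exact_mod_cast hn
  have hR : ∀ x, LSQ.RL P' x ≤ ⌊ε * n⌋₊ := by
    intro x
    refine le_trans ?_ (Nat.le_floor (hr (e.symm x)))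
    refine Finset.card_le_card_of_injOn (fun p => e.symm p.1) ?_ ?_
    · rintro ⟨y, z⟩ h
      have h1 : P (e.symm x) (e.symm y) = some (e.symm z) := by simpa [P'] using h
      simp [h1]
    · rintro ⟨y, z⟩ h ⟨y', z'⟩ h' heq
      have h1 : P (e.symm x) (e.symm y) = some (e.symm z) := by simpa [P'] using h
      have h1' : P (e.symm x) (e.symm y') = some (e.symm z') := by simpa [P'] using h'
      have h3 : y = y' := e.symm.injective heq
      subst h3
      rw [h1] at h1'
      have h4 : z = z' := e.symm.injective (Option.some.inj h1')
      rw [h4]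
  have hC : ∀ x, LSQ.CL P' x ≤ ⌊ε * n⌋₊ := by
    intro x
    refine le_trans ?_ (Nat.le_floor (hc (e.symm x)))
    refine Finset.card_le_card_of_injOn (fun p => e.symm p.1) ?_ ?_
    · rintro ⟨y, z⟩ h
      have h1 : P (e.symm y) (e.symm x) = some (e.symm z) := by simpa [P'] using h
      simp [h1]
    · rintro ⟨y, z⟩ h ⟨y', z'⟩ h' heq
      have h1 : P (e.symm y) (e.symm x) = some (e.symm z) := by simpa [P'] using h
      have h1' : P (e.symm y') (e.symm x) = some (e.symm z') := by simpa [P'] using h'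
      have h3 : y = y' := e.symm.injective heq
      subst h3
      rw [h1] at h1'
      have h4 : z = z' := e.symm.injective (Option.some.inj h1')
      rw [h4]
  have hS : ∀ x, LSQ.SL P' x ≤ ⌊ε * n⌋₊ := by
    intro x
    refine le_trans ?_ (Nat.le_floor (hsy (e.symm x)))
    refine Finset.card_le_card_of_injOn (fun p => (e.symm p.1, e.symm p.2)) ?_ ?_
    · rintro ⟨y, z⟩ h
      have h1 : P (e.symm y) (e.symm z) = some (e.symm x) := by simpa [P'] using h
      simp [h1]
    · rintro ⟨y, z⟩ h ⟨y', z'⟩ h' heq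
      simpa using heq
  have hT : LSQ.tot P' ≤ filledCells P := by
    refine Finset.card_le_card_of_injOn (fun p => (e.symm p.1, e.symm p.2.1)) ?_ ?_
    · rintro ⟨x, y, z⟩ h
      have h1 : P (e.symm x) (e.symm y) = some (e.symm z) := by simpa [P'] using h
      simp [h1]
    · rintro ⟨x, y, z⟩ h ⟨x', y', z'⟩ h' heq
      have h1 : P (e.symm x) (e.symm y) = some (e.symm z) := by simpa [P'] using h
      have h1' : P (e.symm x') (e.symm y') = some (e.symm z') := by simpa [P'] using h'
      have h3 : x = x' ∧ y = y' := by simpa using heq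
      obtain ⟨h3, h5⟩ := h3
      subst h3
      subst h5
      rw [h1] at h1'
      have h4 : z = z' := e.symm.injective (Option.some.inj h1')
      rw [h4]
  have hfl : ((⌊ε * n⌋₊ : ℕ) : ℝ) ≤ ε * n := Nat.floor_le (by positivity)
  have h12 : 12 * ⌊ε * n⌋₊ ≤ n := by
    have : (12 : ℝ) * (⌊ε * n⌋₊ : ℕ) ≤ n := by nlinarith
    exact_mod_cast this
  obtain ⟨N, hN⟩ : ∃ N, N + 12 * ⌊ε * n⌋₊ = n := ⟨n - 12 * ⌊ε * n⌋₊, by omega⟩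
  have hNr : (N : ℝ) + 12 * (⌊ε * n⌋₊ : ℕ) = n := by exact_mod_cast hN
  have hNge : (1 - 12 * ε) * n ≤ N := by linarith
  have hnum : 10409 * LSQ.tot P' < N ^ 2 := by
    have h1 : (LSQ.tot P' : ℝ) ≤ filledCells P := by exact_mod_cast hT
    have h3 : δ * n ^ 2 < (1 - 12 * ε) ^ 2 / 10409 * n ^ 2 :=
      mul_lt_mul_of_pos_right hδ (by positivity)
    have h4 : ((1 - 12 * ε) * n) ^ 2 ≤ (N : ℝ) ^ 2 := by
      apply pow_le_pow_left₀ _ hNge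
      apply mul_nonneg _ hn'.le
      linarith
    have h5 : (10409 : ℝ) * LSQ.tot P' < (N : ℝ) ^ 2 := by nlinarith
    exact_mod_cast h5
  obtain ⟨T, hLat, hPT⟩ := LSQ.complete (P := P') hF (by omega)
    (fun x y y' z h h' => e.symm.injective (hP.1 _ _ _ _ h h'))
    (fun x x' y z h h' => e.symm.injective (hP.2 _ _ _ _ h h'))
    (fun x y z z' h h' => e.symm.injective (Option.some.inj (h.symm.trans h')))
    hR hC hS (by omega) (by omega) hnum
  choose f hf using hLat.e3
  refine ⟨fun i j => e.symm (f (e i) (e j)), ⟨fun i => ?_, fun j => ?_⟩, fun i j s h => ?_⟩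
  · apply Finite.injective_iff_bijective.mp
    intro a b h
    have h1 : f (e i) (e a) = f (e i) (e b) := e.symm.injective h
    have h3 := hf (e i) (e a)
    rw [h1] at h3
    exact e.injective (hLat.u2 h3 (hf (e i) (e b)))
  · apply Finite.injective_iff_bijective.mp
    intro a b h
    have h1 : f (e a) (e j) = f (e b) (e j) := e.symm.injective h
    have h3 := hf (e a) (e j)
    rw [h1] at h3
    exact e.injective (hLat.u1 h3 (hf (e b) (e j)))
  · have h1 : T (e i) (e j) (e s) := hPT _ _ _ (by simpa [P'] using h)
    have h3 := hLat.u3 (hf (e i) (e j)) h1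
    simp [h3]
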